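/- arXiv:2605.31374 — 4 statements merged into one kernel-verified Lean document; each statement's English description precedes it below -/
import Mathlib

section
/- Let n ∈ 2ℕ, let x₁,…,x_n ∈ ℝ² be distinct, let ξ ∈ {−1,+1}^n with ∑_{i=1}^n ξ_i = 0, and let ε > 0. Define F_{x,ξ,ε} := ∑_{i=1}^n (ξ_i/(2ε²)) 1_{B_ε(x_i)}. Then (1/(2π²)) ∬_{ℝ²×ℝ²} F_{x,ξ,ε}(z) F_{x,ξ,ε}(z′) log|z−z′| dz dz′ = (n/8) log ε + n c₀ + ∑_{1≤i<j≤n} ξ_i ξ_j ((1/4) log|x_i−x_j| + 2 c_ε(x_i−x_j)); equivalently, exp of the left-hand side equals ε^{n/8} e^{n c₀} ∏_{1≤i<j≤n} (|x_i−x_j|^{ξ_iξ_j/4} e^{2ξ_iξ_j c_ε(x_i−x_j)}). -/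
open MeasureTheory Real Finset

/-- `c₀ = (1/(8π²)) ∬_{B₁(0)×B₁(0)} log|z−z′| dz dz′`. -/
noncomputable def c₀ : ℝ :=
  (1 / (8 * π ^ 2)) *
    ∫ z in Metric.closedBall (0 : EuclideanSpace ℝ (Fin 2)) 1,
      ∫ z' in Metric.closedBall (0 : EuclideanSpace ℝ (Fin 2)) 1,
        Real.log ‖z - z'‖

/-- `c_ε(v) = (1/(8π²)) ∬_{B₁(0)×B₁(0)} log(|v+ε(z−z′)|/|v|) dz dz′`. -/
noncomputable def cEps (ε : ℝ) (v : EuclideanSpace ℝ (Fin 2)) : ℝ :=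
  (1 / (8 * π ^ 2)) *
    ∫ z in Metric.closedBall (0 : EuclideanSpace ℝ (Fin 2)) 1,
      ∫ z' in Metric.closedBall (0 : EuclideanSpace ℝ (Fin 2)) 1,
        Real.log (‖v + ε • (z - z')‖ / ‖v‖)

/-- The test function `F_{x,ξ,ε} = ∑ i, (ξ i/(2ε²)) 1_{B_ε(x i)}`. -/
noncomputable def testF {n : ℕ} (x : Fin n → EuclideanSpace ℝ (Fin 2))
    (ξ : Fin n → ℤ) (ε : ℝ) (z : EuclideanSpace ℝ (Fin 2)) : ℝ :=
  ∑ i, ((ξ i : ℝ) / (2 * ε ^ 2)) *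
    (Metric.closedBall (x i) ε).indicator (fun _ => (1 : ℝ)) z

/-- The Euclidean plane. -/
abbrev Plane : Type := EuclideanSpace ℝ (Fin 2)

instance isFiniteMeasure_restrict_closedBall (p : Plane) (r : ℝ) :
    IsFiniteMeasure (volume.restrict (Metric.closedBall p r)) :=
  isFiniteMeasure_restrict.2 measure_closedBall_lt_top.ne

lemma integrableOn_log_norm_ball (R : ℝ) :
    IntegrableOn (fun z : Plane => Real.log ‖z‖) (Metric.ball 0 R) := by
  rw [integrableOn_fun_norm_addHaar volume (f := Real.log)]
  simp only [finrank_euclideanSpace, Fintype.card_fin, Nat.add_one_sub_one, pow_one, smul_eq_mul]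
  exact (Real.continuous_mul_log.integrableOn_Icc (a := 0) (b := R)).mono_set
    Set.Ioo_subset_Icc_self

/-- The logarithmic kernel is integrable on every product of two discs. -/
lemma integrable_log_norm_sub (p q : Plane) (r : ℝ) :
    Integrable (fun w : Plane × Plane => Real.log ‖w.1 - w.2‖)
      ((volume.restrict (Metric.closedBall p r)).prod
        (volume.restrict (Metric.closedBall q r))) := by
  set R : ℝ := ‖p - q‖ + 2 * r + 1
  have hfst : Integrable (fun w : Plane × Plane => Real.log ‖w.1‖)
      ((volume.restrict (Metric.ball 0 R)).prod
        (volume.restrict (Metric.closedBall q r))) :=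
    Integrable.comp_fst (integrableOn_log_norm_ball R) _
  rw [Measure.prod_restrict] at hfst ⊢
  have hmp := (measurePreserving_sub_prod (volume : Measure Plane)
    (volume : Measure Plane)).restrict_preimage
      (s := Metric.ball (0 : Plane) R ×ˢ Metric.closedBall q r)
      (measurableSet_ball.prod measurableSet_closedBall)
  refine IntegrableOn.mono_set (hmp.integrable_comp_of_integrable hfst) ?_
  rintro ⟨z, z'⟩ ⟨hz, hz'⟩
  refine ⟨?_, hz'⟩
  simp only [Metric.mem_closedBall, dist_eq_norm, Metric.mem_ball, sub_zero] at hz hz' ⊢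
  calc ‖z - z'‖ = ‖(z - p) + (p - q) - (z' - q)‖ := by congr 1; abel
    _ ≤ ‖z - p‖ + ‖p - q‖ + ‖z' - q‖ :=
      (norm_sub_le _ _).trans (by gcongr; exact norm_add_le _ _)
    _ < R := by simp only [R]; linarith

lemma integrableOn_log_norm_sub (z q : Plane) (r : ℝ) :
    IntegrableOn (fun z' : Plane => Real.log ‖z - z'‖) (Metric.closedBall q r) := by
  have hmp := (Measure.measurePreserving_sub_left (volume : Measure Plane) z).restrict_preimage
    (s := Metric.ball (0 : Plane) (‖z - q‖ + r + 1)) measurableSet_ball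
  refine IntegrableOn.mono_set
    (hmp.integrable_comp_of_integrable (integrableOn_log_norm_ball _)) ?_
  intro z' hz'
  simp only [Metric.mem_closedBall, dist_eq_norm, Metric.mem_ball, sub_zero,
    Set.mem_preimage] at hz' ⊢
  calc ‖z - z'‖ = ‖(z - q) - (z' - q)‖ := by congr 1; abel
    _ ≤ ‖z - q‖ + ‖z' - q‖ := norm_sub_le _ _
    _ < _ := by linarith

/-- The logarithmic interaction energy of two discs of radius `r`. -/
noncomputable def discEnergy (r : ℝ) (p q : Plane) : ℝ :=
  ∫ z in Metric.closedBall p r, ∫ z' in Metric.closedBall q r, Real.log ‖z - z'‖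

lemma discEnergy_comm (r : ℝ) (p q : Plane) : discEnergy r p q = discEnergy r q p := by
  unfold discEnergy
  rw [integral_integral_swap (integrable_log_norm_sub p q r)]
  simp only [norm_sub_rev]

lemma setIntegral_closedBall_eq_unit {r : ℝ} (hr : 0 < r) (p : Plane) (f : Plane → ℝ) :
    ∫ z in Metric.closedBall p r, f z =
      r ^ 2 * ∫ u in Metric.closedBall (0 : Plane) 1, f (p + r • u) := by
  have htrans := (measurePreserving_add_left (volume : Measure Plane) p).setIntegral_preimage_emb
    (MeasurableEquiv.addLeft p).measurableEmbedding f (Metric.closedBall p r)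
  rw [Measure.setIntegral_comp_smul_of_pos volume (fun u => f (p + u)) _ hr,
    smul_unitClosedBall_of_nonneg hr.le, ← htrans, preimage_add_closedBall]
  simp [hr.ne']

lemma discEnergy_sub_log {r a : ℝ} (hr : 0 < r) (ha : 0 < a) (p q : Plane) :
    discEnergy r p q - (π * r ^ 2) ^ 2 * Real.log a =
      r ^ 4 * ∫ z in Metric.closedBall (0 : Plane) 1, ∫ z' in Metric.closedBall (0 : Plane) 1,
        Real.log (‖(p - q) + r • (z - z')‖ / a) := by
  have hvol (c : Plane) : volume.real (Metric.closedBall c r) = π * r ^ 2 := by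
    rw [Measure.real, EuclideanSpace.volume_closedBall_fin_two]
    simp [hr.le, pi_pos.le, mul_comm]
  have hscale : ∫ z in Metric.closedBall p r, ∫ z' in Metric.closedBall q r,
      Real.log (‖z - z'‖ / a) =
      r ^ 4 * ∫ z in Metric.closedBall (0 : Plane) 1, ∫ z' in Metric.closedBall (0 : Plane) 1,
        Real.log (‖(p - q) + r • (z - z')‖ / a) := by
    simp only [setIntegral_closedBall_eq_unit hr, integral_const_mul]
    rw [← mul_assoc, ← pow_add]
    congr! 8
    rw [smul_sub]; abel_nf
  have hinner (z : Plane) : ∫ z' in Metric.closedBall q r, Real.log (‖z - z'‖ / a) =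
      (∫ z' in Metric.closedBall q r, Real.log ‖z - z'‖) - π * r ^ 2 * Real.log a := by
    calc _ = ∫ z' in Metric.closedBall q r, (Real.log ‖z - z'‖ - Real.log a) := by
          refine integral_congr_ae (ae_restrict_of_ae ?_)
          filter_upwards [Measure.ae_ne volume z] with z' hz'
          exact Real.log_div (norm_ne_zero_iff.2 (sub_ne_zero.2 hz'.symm)) ha.ne'
      _ = _ := by
          rw [integral_sub (integrableOn_log_norm_sub z q r) (integrable_const _),
            setIntegral_const, hvol,
            smul_eq_mul]
  rw [← hscale]
  simp only [hinner]
  rw [integral_sub (integrable_log_norm_sub p q r).integral_prod_left (integrable_const _),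
    setIntegral_const, hvol, smul_eq_mul, discEnergy]
  ring

lemma discEnergy_self {r : ℝ} (hr : 0 < r) (p : Plane) :
    discEnergy r p p = π ^ 2 * r ^ 4 * (Real.log r + 8 * c₀) := by
  have h := discEnergy_sub_log hr hr p p
  simp only [sub_self, zero_add, norm_smul, Real.norm_of_nonneg hr.le,
    mul_div_cancel_left₀ _ hr.ne'] at h
  rw [c₀]
  field_simp
  linarith

lemma discEnergy_of_ne {r : ℝ} (hr : 0 < r) {p q : Plane} (hpq : p ≠ q) :
    discEnergy r p q = π ^ 2 * r ^ 4 * (Real.log ‖p - q‖ + 8 * cEps r (p - q)) := by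
  have h := discEnergy_sub_log hr (norm_pos_iff.2 (sub_ne_zero.2 hpq)) p q
  rw [cEps]
  field_simp
  linarith

lemma integral_testF_mul {n : ℕ} (x : Fin n → Plane) (ξ : Fin n → ℤ) (ε : ℝ) {g : Plane → ℝ}
    (hg : ∀ i, IntegrableOn g (Metric.closedBall (x i) ε)) :
    ∫ z, testF x ξ ε z * g z =
      ∑ i, (ξ i : ℝ) / (2 * ε ^ 2) * ∫ z in Metric.closedBall (x i) ε, g z := by
  have hpt (z : Plane) : testF x ξ ε z * g z =
      ∑ i, (ξ i : ℝ) / (2 * ε ^ 2) * (Metric.closedBall (x i) ε).indicator g z := by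
    simp only [testF, sum_mul]
    refine sum_congr rfl fun i _ => ?_
    by_cases h : z ∈ Metric.closedBall (x i) ε <;> simp [h]
  simp only [hpt]
  rw [integral_finsetSum _ fun i _ =>
    ((hg i).integrable_indicator measurableSet_closedBall).const_mul _]
  simp only [integral_const_mul, integral_indicator measurableSet_closedBall]

lemma integral_testF_energy {n : ℕ} (x : Fin n → Plane) (ξ : Fin n → ℤ) (ε : ℝ) :
    ∫ z, ∫ z', testF x ξ ε z * testF x ξ ε z' * Real.log ‖z - z'‖ =
      ∑ i, ∑ j, (ξ i : ℝ) * ξ j / (4 * ε ^ 4) * discEnergy ε (x i) (x j) := by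
  have hint (i j : Fin n) : IntegrableOn
      (fun z => ∫ z' in Metric.closedBall (x j) ε, Real.log ‖z - z'‖)
      (Metric.closedBall (x i) ε) :=
    (integrable_log_norm_sub (x i) (x j) ε).integral_prod_left
  simp only [mul_assoc, integral_const_mul]
  simp only [integral_testF_mul x ξ ε fun j => integrableOn_log_norm_sub _ (x j) ε]
  rw [integral_testF_mul x ξ ε fun i =>
    integrable_finsetSum _ fun j _ => (hint i j).const_mul _]
  refine sum_congr rfl fun i _ => ?_
  rw [integral_finsetSum _ fun j _ => (hint i j).const_mul _, mul_sum]
  refine sum_congr rfl fun j _ => ?_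
  rw [integral_const_mul, discEnergy]
  ring

lemma sum_sum_of_symm {n : ℕ} (f : Fin n → Fin n → ℝ) (hf : ∀ i j, f i j = f j i) :
    ∑ i, ∑ j, f i j = ∑ i, f i i + ∑ i, ∑ j ∈ Finset.Ioi i, 2 * f i j := by
  have h := sum_sum_Ioi_add_eq_sum_sum_off_diag f
  have hdiag (i : Fin n) : ∑ j, f i j = f i i + ∑ j ∈ {i}ᶜ, f i j := by
    rw [← sum_add_sum_compl {i}, sum_singleton]
  have hswap : ∑ i, ∑ j ∈ {i}ᶜ, f i j = ∑ i, ∑ j ∈ {i}ᶜ, f j i :=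
    sum_congr rfl fun i _ => sum_congr rfl fun j _ => hf i j
  simp only [hdiag, sum_add_distrib]
  rw [hswap, ← h]
  congr 1
  refine sum_congr rfl fun i _ => sum_congr rfl fun j _ => ?_
  rw [hf j i]; ring

/-- For `n ∈ 2ℕ`, distinct points `x₁,…,x_n ∈ ℝ²`, balanced signs `ξ ∈ {−1,+1}^n`
(`∑ ξ i = 0`) and `ε > 0`, the Gaussian free field quadratic form of `F_{x,ξ,ε}`:
`(1/(2π²)) ∬ F(z)F(z′) log|z−z′| dz dz′
  = (n/8) log ε + n c₀ + ∑_{i<j} ξ_i ξ_j ((1/4) log|x_i−x_j| + 2 c_ε(x_i−x_j))`. -/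
theorem stmt9 (n : ℕ) (hn : Even n) (hn0 : 0 < n)
    (x : Fin n → EuclideanSpace ℝ (Fin 2)) (hx : Function.Injective x)
    (ξ : Fin n → ℤ) (hξ : ∀ i, ξ i = -1 ∨ ξ i = 1) (hbal : ∑ i, ξ i = 0)
    (ε : ℝ) (hε : 0 < ε) :
    (1 / (2 * π ^ 2)) *
        ∫ z : EuclideanSpace ℝ (Fin 2), ∫ z' : EuclideanSpace ℝ (Fin 2),
          testF x ξ ε z * testF x ξ ε z' * Real.log ‖z - z'‖
      = (n / 8 : ℝ) * Real.log ε + (n : ℝ) * c₀ +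
          ∑ i, ∑ j ∈ Finset.Ioi i,
            (ξ i : ℝ) * (ξ j : ℝ) *
              ((1 / 4) * Real.log ‖x i - x j‖ + 2 * cEps ε (x i - x j)) := by
 
  have hπ := Real.pi_ne_zero
  have hsq (i : Fin n) : (ξ i : ℝ) * ξ i = 1 := by
    rcases hξ i with h | h <;> simp [h]
  rw [integral_testF_energy, sum_sum_of_symm _ fun i j => by
    rw [discEnergy_comm, mul_comm (ξ i : ℝ)], mul_add]
  congr 1
  · simp only [hsq, discEnergy_self hε, sum_const, card_univ, Fintype.card_fin, nsmul_eq_mul]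
    field_simp
    ring
  · simp only [mul_sum]
    refine sum_congr rfl fun i _ => sum_congr rfl fun j hj => ?_
    rw [discEnergy_of_ne hε (hx.ne (mem_Ioi.1 hj).ne)]
    field_simp
    ring
end

section
/- Let k ∈ ℕ and let h : ℝ² → ℝ be measurable with B_h := ∬_{ℝ²×ℝ²} |h(x)||h(y)| |x−y|^{−1/4} dx dy < ∞. Then for every ξ ∈ {−1,+1}^{2k} with ∑_{i=1}^{2k} ξ_i = 0, ∫_{(ℝ²)^{2k}} ∏_{ℓ=1}^{2k} |h(x_ℓ)| ∏_{1≤i<j≤2k} |x_i−x_j|^{ξ_iξ_j/4} dx₁⋯dx_{2k} ≤ k! · B_h^k. -/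
open MeasureTheory Finset ENNReal

/-- The product of `f i j` over the pairs `i < j` in `Fin n`. -/
def prodPairs {n : ℕ} (f : Fin n → Fin n → ℝ) : ℝ := ∏ i, ∏ j ∈ Finset.Ioi i, f i j

lemma prodPairs_nonneg {n : ℕ} {f : Fin n → Fin n → ℝ} (hf : ∀ i j, 0 ≤ f i j) :
    0 ≤ prodPairs f :=
  Finset.prod_nonneg fun _ _ => Finset.prod_nonneg fun _ _ => hf _ _

lemma prodPairs_eq_zero {n : ℕ} {f : Fin n → Fin n → ℝ} {i j : Fin n} (hij : i < j)
    (h : f i j = 0) : prodPairs f = 0 :=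
  Finset.prod_eq_zero (Finset.mem_univ i) (Finset.prod_eq_zero (Finset.mem_Ioi.2 hij) h)

lemma prodPairs_succ {n : ℕ} (f : Fin (n + 1) → Fin (n + 1) → ℝ) :
    prodPairs f = (∏ i : Fin n, f 0 i.succ) * prodPairs fun i j : Fin n => f i.succ j.succ := by
  simp [prodPairs, Fin.prod_univ_succ, Fin.prod_Ioi_succ]

lemma prodPairs_sq {n : ℕ} {f : Fin n → Fin n → ℝ} (hf : ∀ i j, f i j = f j i) :
    prodPairs f ^ 2 = ∏ i, ∏ j, if i = j then 1 else f i j := by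
  induction n with
  | zero => simp [prodPairs]
  | succ n ih =>
    rw [prodPairs_succ, mul_pow, ih fun i j => hf _ _]
    simp_rw [Fin.prod_univ_succ, Fin.succ_inj, Finset.prod_mul_distrib]
    simp only [if_true, Fin.succ_ne_zero, (Fin.succ_ne_zero _).symm, if_false, hf _ 0]
    ring

lemma prodPairs_comp_perm {n : ℕ} {f : Fin n → Fin n → ℝ} (hf : ∀ i j, f i j = f j i)
    (hf0 : ∀ i j, 0 ≤ f i j) (σ : Equiv.Perm (Fin n)) :
    (prodPairs fun i j => f (σ i) (σ j)) = prodPairs f := by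
  refine (pow_left_inj₀ (prodPairs_nonneg fun _ _ => hf0 _ _) (prodPairs_nonneg hf0)
    two_ne_zero).1 ?_
  rw [prodPairs_sq fun i j => hf _ _, prodPairs_sq hf,
    ← Equiv.prod_comp σ fun i => ∏ j, if i = j then 1 else f i j]
  refine Finset.prod_congr rfl fun i _ => ?_
  rw [← Equiv.prod_comp σ fun j => if σ i = j then 1 else f (σ i) j]
  simp

lemma rpow_sum_le_sum_rpow {ι : Type*} (s : Finset ι) {f : ι → ℝ} (hf : ∀ i, 0 ≤ f i) {p : ℝ}
    (hp : 0 < p) (hp1 : p ≤ 1) : (∑ i ∈ s, f i) ^ p ≤ ∑ i ∈ s, f i ^ p := by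
  induction s using Finset.cons_induction with
  | empty => simp [Real.zero_rpow hp.ne']
  | cons a s ha ih =>
    rw [Finset.sum_cons, Finset.sum_cons]
    exact (Real.rpow_add_le_add_rpow (hf a) (Finset.sum_nonneg fun i _ => hf i) hp.le hp1).trans
      (by gcongr)

lemma prod_ne_eq_prod_swap_succ {n : ℕ} (f : Fin (n + 1) → ℝ) (j : Fin (n + 1)) :
    ∏ l ∈ Finset.univ.erase j, f l = ∏ i : Fin n, f (Equiv.swap 0 j i.succ) := by
  have h : ∏ l ∈ Finset.univ.erase j, f l = ∏ l, if l = j then 1 else f l := by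
    rw [← Finset.mul_prod_erase Finset.univ _ (Finset.mem_univ j), if_pos rfl, one_mul]
    exact Finset.prod_congr rfl fun l hl => (if_neg (Finset.ne_of_mem_erase hl)).symm
  rw [h, ← Equiv.prod_comp (Equiv.swap 0 j), Fin.prod_univ_succ]
  simp only [Equiv.swap_apply_left, if_true, one_mul]
  refine Finset.prod_congr rfl fun i _ => if_neg fun hi => ?_
  exact Fin.succ_ne_zero i ((Equiv.swap 0 j).injective (hi.trans (Equiv.swap_apply_left 0 j).symm))

lemma norm_lagrange_le {n : ℕ} (x : ℂ) (z : Fin n → ℂ) {w : Fin (n + 1) → ℂ}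
    (hw : Function.Injective w) (hx : ∀ j, x ≠ w j) :
    (∏ i, ‖x - z i‖) * ∏ j, ‖x - w j‖⁻¹ ≤
      ∑ j, ‖x - w j‖⁻¹ * (∏ i, ‖w j - z i‖) * ∏ i : Fin n, ‖w j - w (Equiv.swap 0 j i.succ)‖⁻¹ := by
  have hP := Lagrange.eq_interpolate (s := Finset.univ) (v := w) (f := Lagrange.nodal Finset.univ z)
    hw.injOn (by rw [Lagrange.degree_nodal]; exact_mod_cast by simp)
  have hx' := congrArg (Polynomial.eval x) hP
  rw [Lagrange.eval_interpolate_not_at_node _ fun j _ => hx j] at hx'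
  simp only [Lagrange.eval_nodal] at hx'
  rw [← norm_prod, hx', norm_mul, norm_prod, mul_right_comm, ← Finset.prod_mul_distrib,
    Finset.prod_eq_one fun j _ => mul_inv_cancel₀ (norm_ne_zero_iff.2 (sub_ne_zero.2 (hx j))),
    one_mul]
  refine (norm_sum_le _ _).trans (Finset.sum_le_sum fun j _ => le_of_eq ?_)
  rw [norm_mul, norm_mul, Lagrange.nodalWeight, norm_prod, norm_prod, norm_inv]
  simp_rw [norm_inv]
  rw [prod_ne_eq_prod_swap_succ fun l => ‖w j - w l‖⁻¹]
  ring

lemma rpow_lagrange_le {n : ℕ} {p : ℝ} (hp : 0 < p) (hp1 : p ≤ 1) (x : ℂ) (z : Fin n → ℂ)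
    {w : Fin (n + 1) → ℂ} (hw : Function.Injective w) (hx : ∀ j, x ≠ w j) :
    (∏ i, ‖x - z i‖ ^ p) * ∏ j, (‖x - w j‖ ^ p)⁻¹ ≤
      ∑ j, (‖x - w j‖ ^ p)⁻¹ * (∏ i, ‖w j - z i‖ ^ p) *
        ∏ i : Fin n, (‖w j - w (Equiv.swap 0 j i.succ)‖ ^ p)⁻¹ := by
  have h := (Real.rpow_le_rpow (by positivity) (norm_lagrange_le x z hw hx) hp.le).trans
    (rpow_sum_le_sum_rpow _ (fun j => by positivity) hp hp1)
  have hprod : ∀ {m : ℕ} (f : Fin m → ℝ), (∀ i, 0 ≤ f i) → (∏ i, f i) ^ p = ∏ i, f i ^ p :=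
    fun f hf => (Real.finsetProd_rpow _ _ (fun i _ => hf i) p).symm
  rw [Real.mul_rpow (by positivity) (by positivity), hprod _ fun _ => by positivity,
    hprod _ fun _ => by positivity] at h
  simp_rw [← Real.inv_rpow (norm_nonneg _)]
  refine h.trans (le_of_eq (Finset.sum_congr rfl fun j _ => ?_))
  rw [Real.mul_rpow (by positivity) (by positivity), Real.mul_rpow (by positivity) (by positivity),
    hprod _ fun _ => by positivity, hprod _ fun _ => by positivity]

/-- A power-`p` form of the bound obtained from Cauchy's determinant identity. -/
theorem prodPairs_mul_prodPairs_mul_le_sum_perm {p : ℝ} (hp : 0 < p) (hp1 : p ≤ 1) {n : ℕ}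
    (z w : Fin n → ℂ) :
    (prodPairs fun i j => ‖z i - z j‖ ^ p) * (prodPairs fun i j => ‖w i - w j‖ ^ p) *
        ∏ i, ∏ j, (‖z i - w j‖ ^ p)⁻¹ ≤
      ∑ σ : Equiv.Perm (Fin n), ∏ i, (‖z i - w (σ i)‖ ^ p)⁻¹ := by
  have hnn : 0 ≤ ∑ σ : Equiv.Perm (Fin n), ∏ i, (‖z i - w (σ i)‖ ^ p)⁻¹ := by positivity
  induction n with
  | zero => simp [prodPairs]
  | succ n ih =>
    by_cases hw : Function.Injective w
    swap
    · obtain ⟨i, j, hij, hne⟩ : ∃ i j, w i = w j ∧ i < j := by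
        simp only [Function.Injective, not_forall] at hw
        obtain ⟨i, j, h, hne⟩ := hw
        rcases lt_or_gt_of_ne hne with h' | h'
        exacts [⟨i, j, h, h'⟩, ⟨j, i, h.symm, h'⟩]
      rw [prodPairs_eq_zero (f := fun i j => ‖w i - w j‖ ^ p) hne (by simp [hij, hp.ne'])]
      simpa using hnn
    by_cases hx : ∀ j, z 0 ≠ w j
    swap
    · push Not at hx
      obtain ⟨j, hj⟩ := hx
      rw [Finset.prod_eq_zero (Finset.mem_univ 0)
        (Finset.prod_eq_zero (Finset.mem_univ j) (by simp [hj, hp.ne']))]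
      simpa using hnn
    have key := rpow_lagrange_le hp hp1 (z 0) (fun i => z i.succ) hw hx
    set V := prodPairs fun i j : Fin n => ‖z i.succ - z j.succ‖ ^ p
    have hV0 : 0 ≤ V := prodPairs_nonneg fun _ _ => by positivity
    have hW0 : 0 ≤ prodPairs fun i j => ‖w i - w j‖ ^ p := prodPairs_nonneg fun _ _ => by positivity
    rw [prodPairs_succ, Fin.prod_univ_succ]
    calc _ = ((∏ i : Fin n, ‖z 0 - z i.succ‖ ^ p) * ∏ j, (‖z 0 - w j‖ ^ p)⁻¹) *
          (V * (prodPairs fun i j => ‖w i - w j‖ ^ p) *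
            ∏ i : Fin n, ∏ j, (‖z i.succ - w j‖ ^ p)⁻¹) := by ring
      _ ≤ _ := mul_le_mul_of_nonneg_right key (by positivity)
      _ ≤ ∑ j, (‖z 0 - w j‖ ^ p)⁻¹ * ∑ σ : Equiv.Perm (Fin n),
            ∏ i : Fin n, (‖z i.succ - w (Equiv.swap 0 j (σ i).succ)‖ ^ p)⁻¹ := ?_
      _ = _ := ?_
    · rw [Finset.sum_mul]
      refine Finset.sum_le_sum fun j _ => ?_
      refine le_trans ?_ (mul_le_mul_of_nonneg_left
        (ih (fun i => z i.succ) (fun i => w (Equiv.swap 0 j i.succ)) (by positivity))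
        (by positivity))
      have hperm := prodPairs_comp_perm (f := fun i j => ‖w i - w j‖ ^ p)
        (fun i j => by simp_rw [norm_sub_rev]) (fun i j => by positivity) (Equiv.swap 0 j)
      rw [← hperm, prodPairs_succ]
      simp only [Equiv.swap_apply_left]
      have hz : ∀ i : Fin n, ∏ l, (‖z i.succ - w l‖ ^ p)⁻¹ = (‖w j - z i.succ‖ ^ p)⁻¹ *
          ∏ l : Fin n, (‖z i.succ - w (Equiv.swap 0 j l.succ)‖ ^ p)⁻¹ := fun i => by
        rw [← Equiv.prod_comp (Equiv.swap 0 j), Fin.prod_univ_succ, Equiv.swap_apply_left,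
          norm_sub_rev]
      simp_rw [hz, Finset.prod_mul_distrib, Finset.prod_inv_distrib]
      have hW1 : 0 ≤ prodPairs fun i l : Fin n =>
          ‖w (Equiv.swap 0 j i.succ) - w (Equiv.swap 0 j l.succ)‖ ^ p :=
        prodPairs_nonneg fun _ _ => by positivity
      have h1 := mul_inv_le_one (a := ∏ i : Fin n, ‖w j - z i.succ‖ ^ p)
      have h2 := mul_inv_le_one (a := ∏ i : Fin n, ‖w j - w (Equiv.swap 0 j i.succ)‖ ^ p)
      have h12 := mul_le_one₀ h1 (by positivity) h2
      refine le_of_eq_of_le ?_ (mul_le_of_le_one_right ?_ h12)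
      · ring
      · positivity
    · rw [← Equiv.sum_comp Equiv.Perm.decomposeFin.symm, Fintype.sum_prod_type]
      refine Finset.sum_congr rfl fun j _ => ?_
      rw [Finset.mul_sum]
      refine Finset.sum_congr rfl fun σ _ => ?_
      simp [Fin.prod_univ_succ, mul_comm]

lemma lintegral_pi_prod_eq_pow {α : Type*} [MeasureSpace α] [SigmaFinite (volume : Measure α)]
    {F : α → ℝ≥0∞} (hF : Measurable F) (n : ℕ) :
    ∫⁻ x : Fin n → α, ∏ i, F (x i) = (∫⁻ a, F a) ^ n := by
  induction n with
  | zero => simp [volume_pi]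
  | succ n ih =>
    rw [← (volume_preserving_piFinSuccAbove (fun _ : Fin (n + 1) => α) 0).symm.lintegral_comp_emb
      (MeasurableEquiv.measurableEmbedding _)]
    simp_rw [MeasurableEquiv.piFinSuccAbove_symm_apply, Fin.insertNthEquiv, Fin.prod_univ_succ]
    simp only [Fin.insertNth_zero, Equiv.coe_fn_mk, Fin.cons_zero, Fin.cons_succ]
    change ∫⁻ a : α × (Fin n → α), F a.1 * ∏ i, F (a.2 i) = _
    have hG : Measurable fun x : Fin n → α => ∏ i, F (x i) := by fun_prop
    rw [Measure.volume_eq_prod, lintegral_prod_mul hF.aemeasurable hG.aemeasurable, ih, pow_succ']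

lemma lintegral_pi_prod_pairs_eq_pow {α ι : Type*} [Fintype ι] [MeasureSpace α]
    [SigmaFinite (volume : Measure α)] {F : α × α → ℝ≥0∞} (hF : Measurable F) {n : ℕ}
    (e : Fin n ⊕ Fin n ≃ ι) :
    ∫⁻ x : ι → α, ∏ i, F (x (e (.inl i)), x (e (.inr i))) = (∫⁻ p, F p) ^ n := by
  rw [← (volume_measurePreserving_piCongrLeft (fun _ : ι => α) e).lintegral_comp_emb
      (MeasurableEquiv.measurableEmbedding _),
    ← (volume_measurePreserving_sumPiEquivProdPi_symm
      (fun _ : Fin n ⊕ Fin n => α)).lintegral_comp_emb (MeasurableEquiv.measurableEmbedding _),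
    ← (volume_measurePreserving_arrowProdEquivProdArrow α α (Fin n)).lintegral_comp_emb
      (MeasurableEquiv.measurableEmbedding _), ← lintegral_pi_prod_eq_pow hF]
  refine lintegral_congr fun x => Finset.prod_congr rfl fun i _ => ?_
  simp only [MeasurableEquiv.coe_piCongrLeft, Equiv.piCongrLeft_apply_apply]
  rfl

lemma exists_equiv_of_balanced {k : ℕ} {ξ : Fin (2 * k) → ℤ} (hξ : ∀ i, ξ i = -1 ∨ ξ i = 1)
    (hbal : ∑ i, ξ i = 0) :
    ∃ e : Fin k ⊕ Fin k ≃ Fin (2 * k), (∀ i, ξ (e (.inl i)) = 1) ∧ ∀ i, ξ (e (.inr i)) = -1 := by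
  have hsum : Fintype.card {i // ξ i = 1} + Fintype.card {i // ¬ ξ i = 1} = 2 * k := by
    rw [← Fintype.card_sum, Fintype.card_congr (Equiv.sumCompl _), Fintype.card_fin]
  have hdiff : (Fintype.card {i // ξ i = 1} : ℤ) - Fintype.card {i // ¬ ξ i = 1} = 0 := by
    have h₁ : ∀ i : {i // ξ i = 1}, ξ i = 1 := fun i => i.2
    have h₂ : ∀ i : {i // ¬ ξ i = 1}, ξ i = -1 := fun i => (hξ i).resolve_right i.2
    rw [← hbal, ← Equiv.sum_comp (Equiv.sumCompl fun i => ξ i = 1), Fintype.sum_sum_type]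
    simp only [Equiv.sumCompl_apply_inl, Equiv.sumCompl_apply_inr, h₁, h₂]
    simp [sub_eq_add_neg]
  let e₁ := (Fintype.equivFinOfCardEq (show Fintype.card {i // ξ i = 1} = k by omega)).symm
  let e₂ := (Fintype.equivFinOfCardEq (show Fintype.card {i // ¬ ξ i = 1} = k by omega)).symm
  exact ⟨(Equiv.sumCongr e₁ e₂).trans (Equiv.sumCompl _), fun i => (e₁ i).2,
    fun i => (hξ _).resolve_right (e₂ i).2⟩

lemma prodPairs_eq_of_signs {k : ℕ} {ξ : Fin (2 * k) → ℤ} {e : Fin k ⊕ Fin k ≃ Fin (2 * k)}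
    (he₁ : ∀ i, ξ (e (.inl i)) = 1) (he₂ : ∀ i, ξ (e (.inr i)) = -1)
    {a : Fin (2 * k) → Fin (2 * k) → ℝ} (ha : ∀ i j, a i j = a j i) (ha0 : ∀ i j, 0 ≤ a i j) (p : ℝ) :
    (prodPairs fun i j => a i j ^ (((ξ i * ξ j : ℤ) : ℝ) * p)) =
      (prodPairs fun i j => a (e (.inl i)) (e (.inl j)) ^ p) *
        (prodPairs fun i j => a (e (.inr i)) (e (.inr j)) ^ p) *
        ∏ i, ∏ j, (a (e (.inl i)) (e (.inr j)) ^ p)⁻¹ := by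
  have hnn : ∀ (m : ℕ) (f : Fin m → Fin m → Fin (2 * k) × Fin (2 * k)) (q : Fin m → Fin m → ℝ),
      0 ≤ prodPairs fun i j => a (f i j).1 (f i j).2 ^ q i j := fun m f q =>
    prodPairs_nonneg fun _ _ => Real.rpow_nonneg (ha0 _ _) _
  refine (pow_left_inj₀ (hnn _ (fun i j => (i, j)) _) (mul_nonneg (mul_nonneg
    (hnn _ (fun i j => (e (.inl i), e (.inl j))) _) (hnn _ (fun i j => (e (.inr i), e (.inr j))) _))
    (Finset.prod_nonneg fun _ _ => Finset.prod_nonneg fun _ _ =>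
      inv_nonneg.2 (Real.rpow_nonneg (ha0 _ _) _))) two_ne_zero).1 ?_
  rw [mul_pow, mul_pow, prodPairs_sq fun i j => by rw [ha, mul_comm (ξ i)],
    prodPairs_sq fun i j => by rw [ha], prodPairs_sq fun i j => by rw [ha], ← Equiv.prod_comp e]
  simp_rw [← Equiv.prod_comp e fun j => ite _ _ _, Fintype.prod_sum_type]
  simp only [he₁, he₂, e.injective.eq_iff, Sum.inl.injEq, Sum.inr.injEq, reduceCtorEq, if_false,
    Finset.prod_mul_distrib]
  have hinv : ∀ i j, a i j ^ (-p) = (a i j ^ p)⁻¹ := fun i j => Real.rpow_neg (ha0 i j) p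
  simp only [mul_one, one_mul, mul_neg, neg_neg, Int.cast_one, Int.cast_neg, neg_mul, hinv]
  rw [Finset.prod_comm (f := fun i j => (a (e (.inr i)) (e (.inl j)) ^ p)⁻¹)]
  simp only [ha (e (.inr _)) (e (.inl _))]
  ring

lemma prodPairs_signs_le_sum_perm {k : ℕ} {ξ : Fin (2 * k) → ℤ} {e : Fin k ⊕ Fin k ≃ Fin (2 * k)}
    (he₁ : ∀ i, ξ (e (.inl i)) = 1) (he₂ : ∀ i, ξ (e (.inr i)) = -1)
    (x : Fin (2 * k) → EuclideanSpace ℝ (Fin 2)) {p : ℝ} (hp : 0 < p) (hp1 : p ≤ 1) :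
    (prodPairs fun i j => ‖x i - x j‖ ^ (((ξ i * ξ j : ℤ) : ℝ) * p)) ≤
      ∑ σ : Equiv.Perm (Fin k), ∏ i, ‖x (e (.inl i)) - x (e (.inr (σ i)))‖ ^ (-p) := by
  rw [prodPairs_eq_of_signs he₁ he₂ (a := fun i j => ‖x i - x j‖) (fun i j => norm_sub_rev _ _)
    (fun i j => norm_nonneg _)]
  let φ := Complex.orthonormalBasisOneI.repr.symm
  have h := prodPairs_mul_prodPairs_mul_le_sum_perm hp hp1
    (fun i => φ (x (e (.inl i)))) fun i => φ (x (e (.inr i)))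
  simp only [← map_sub, LinearIsometryEquiv.norm_map] at h
  simpa only [Real.rpow_neg (norm_nonneg _)] using h

/-- Moment bound: if `B_h = ∬ |h(x)||h(y)||x−y|^{−1/4} dx dy < ∞`, then for every
balanced sign sequence `ξ ∈ {−1,+1}^{2k}`,
`∫_{(ℝ²)^{2k}} ∏_ℓ |h(x_ℓ)| ∏_{i<j} |x_i−x_j|^{ξ_iξ_j/4} dx₁⋯dx_{2k} ≤ k! B_h^k`. -/
theorem stmt13 (k : ℕ) (h : EuclideanSpace ℝ (Fin 2) → ℝ) (hmeas : Measurable h)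
    (hB : (∫⁻ x : EuclideanSpace ℝ (Fin 2), ∫⁻ y : EuclideanSpace ℝ (Fin 2),
        ENNReal.ofReal (|h x| * |h y| * ‖x - y‖ ^ (-(1 / 4) : ℝ))) ≠ ⊤)
    (ξ : Fin (2 * k) → ℤ) (hξ : ∀ i, ξ i = -1 ∨ ξ i = 1)
    (hbal : ∑ i, ξ i = 0) :
    (∫⁻ x : Fin (2 * k) → EuclideanSpace ℝ (Fin 2),
        ENNReal.ofReal ((∏ ℓ, |h (x ℓ)|) *
          ∏ i, ∏ j ∈ Finset.Ioi i, ‖x i - x j‖ ^ (((ξ i * ξ j : ℤ) : ℝ) / 4)))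
      ≤ (k.factorial : ℝ≥0∞) *
          (∫⁻ x : EuclideanSpace ℝ (Fin 2), ∫⁻ y : EuclideanSpace ℝ (Fin 2),
            ENNReal.ofReal (|h x| * |h y| * ‖x - y‖ ^ (-(1 / 4) : ℝ))) ^ k := by
  obtain ⟨e, he₁, he₂⟩ := exists_equiv_of_balanced hξ hbal
  let F : EuclideanSpace ℝ (Fin 2) × EuclideanSpace ℝ (Fin 2) → ℝ≥0∞ := fun p =>
    ENNReal.ofReal (|h p.1| * |h p.2| * ‖p.1 - p.2‖ ^ (-(1 / 4) : ℝ))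
  have hF : Measurable F := by fun_prop
  have hF_int : ∫⁻ p, F p = ∫⁻ x : EuclideanSpace ℝ (Fin 2), ∫⁻ y : EuclideanSpace ℝ (Fin 2),
      ENNReal.ofReal (|h x| * |h y| * ‖x - y‖ ^ (-(1 / 4) : ℝ)) := by
    rw [Measure.volume_eq_prod, lintegral_prod _ hF.aemeasurable]
  let e' : Equiv.Perm (Fin k) → (Fin k ⊕ Fin k ≃ Fin (2 * k)) := fun σ =>
    (Equiv.sumCongr (Equiv.refl _) σ).trans e
  calc _ ≤ ∫⁻ x : Fin (2 * k) → EuclideanSpace ℝ (Fin 2), ∑ σ : Equiv.Perm (Fin k),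
          ∏ i, F (x (e' σ (.inl i)), x (e' σ (.inr i))) := lintegral_mono fun x => ?_
    _ = ∑ σ : Equiv.Perm (Fin k), (∫⁻ p, F p) ^ k := by
      rw [lintegral_finsetSum]
      · simp_rw [lintegral_pi_prod_pairs_eq_pow hF]
      · intro σ _
        fun_prop
    _ = _ := by simp [hF_int, Fintype.card_perm]
  have hle := prodPairs_signs_le_sum_perm he₁ he₂ x (p := 1 / 4) (by norm_num) (by norm_num)
  simp only [mul_one_div] at hle
  refine (ENNReal.ofReal_le_ofReal (mul_le_mul_of_nonneg_left hle (by positivity))).trans ?_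
  rw [Finset.mul_sum, ENNReal.ofReal_sum_of_nonneg fun σ _ => by positivity]
  refine Finset.sum_le_sum fun σ _ => le_of_eq ?_
  simp only [F]
  rw [← ENNReal.ofReal_prod_of_nonneg fun i _ => by positivity, Finset.prod_mul_distrib,
    Finset.prod_mul_distrib, ← Equiv.prod_comp (e' σ), Fintype.prod_sum_type]
  rfl
end

section
/- Let h : ℝ² → ℝ be bounded, measurable, and compactly supported. Then B_h := ∬_{ℝ²×ℝ²} |h(x)||h(y)||x−y|^{−1/4} dx dy < ∞, and for every k ∈ ℕ, |M_{2k}(h)| ≤ ((2k)!/k!) · B_h^k. Consequently, there exists a constant A_h > 0 such that |M_{2k}(h)| ≤ A_h^{2k} (2k)! for every k ∈ ℕ. -/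
open MeasureTheory Finset

/-- The Coulomb-gas neutral-charge sum
`⟨x₁,…,x_n⟩ = ∑_{ξ ∈ {−1,+1}^n, ∑ ξ_i = 0} ∏_{i<j} |x_i − x_j|^{ξ_i ξ_j/4}`. -/
noncomputable def coulomb (n : ℕ) (x : Fin n → EuclideanSpace ℝ (Fin 2)) : ℝ :=
  ∑ ξ ∈ Finset.filter (fun ξ => ∑ i, ξ i = 0)
      (Fintype.piFinset fun _ : Fin n => ({-1, 1} : Finset ℤ)),
    ∏ i, ∏ j ∈ Finset.Ioi i, ‖x i - x j‖ ^ (((ξ i * ξ j : ℤ) : ℝ) / 4)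

/-- `M_n(h) = ∫_{(ℝ²)^n} h(x₁)⋯h(x_n) ⟨x₁,…,x_n⟩ dx₁⋯dx_n`. -/
noncomputable def momentM (n : ℕ) (h : EuclideanSpace ℝ (Fin 2) → ℝ) : ℝ :=
  ∫ x : Fin n → EuclideanSpace ℝ (Fin 2), (∏ ℓ, h (x ℓ)) * coulomb n x

/-- Lagrange interpolation of `∏ i, (X - x i)` at the nodes `y j`, in partial fraction form. -/
lemma prod_sub_div_prod_sub_eq_sum {F : Type*} [Field F] {k : ℕ} (z : F) (x : Fin k → F)
    (y : Fin (k + 1) → F) (hy : Function.Injective y) (hz : ∀ j, z ≠ y j) :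
    (∏ i, (z - x i)) / ∏ j, (z - y j) =
      ∑ j, (z - y j)⁻¹ * ((∏ i, (y j - x i)) / ∏ l, (y j - y (j.succAbove l))) := by
  classical
  have hdeg : (Lagrange.nodal univ x).degree < #(univ : Finset (Fin (k + 1))) := by
    rw [Lagrange.degree_nodal]
    simp only [card_univ, Fintype.card_fin]
    exact_mod_cast Nat.lt_succ_self k
  have h := congrArg (Polynomial.eval z) (Lagrange.eq_interpolate (v := y) hy.injOn hdeg)
  rw [Lagrange.eval_interpolate_not_at_node _ (fun j _ => hz j)] at h
  simp only [Lagrange.eval_nodal] at h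
  have hne : ∏ j, (z - y j) ≠ 0 := prod_ne_zero_iff.2 fun j _ => sub_ne_zero.2 (hz j)
  rw [h, mul_div_cancel_left₀ _ hne]
  refine sum_congr rfl fun j _ => ?_
  have hw : Lagrange.nodalWeight univ y j = (∏ l, (y j - y (j.succAbove l)))⁻¹ := by
    rw [Lagrange.nodalWeight, prod_inv_distrib]
    congr 1
    have h1 : (univ : Finset (Fin (k + 1))).erase j = univ.map j.succAboveEmb := by
      ext l
      simp only [mem_erase, mem_univ, and_true, mem_map, true_and, Fin.succAboveEmb_apply]
      exact Fin.exists_succAbove_eq_iff.symm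
    rw [h1, prod_map]
    rfl
  rw [hw]
  ring

/-- The Coulomb weight of `k` positive charges at `x` and `k` negative charges at `y`. -/
noncomputable def coulombPair {E : Type*} [NormedAddCommGroup E] {k : ℕ} (x y : Fin k → E) : ℝ :=
  (∏ i, ∏ j, if i = j then 1 else ‖x i - x j‖ ^ (1 / 8 : ℝ)) *
    (∏ i, ∏ j, if i = j then 1 else ‖y i - y j‖ ^ (1 / 8 : ℝ)) *
    (∏ i, ∏ j, ‖x i - y j‖ ^ (1 / 4 : ℝ))⁻¹

lemma coulombPair_nonneg {E : Type*} [NormedAddCommGroup E] {k : ℕ} (x y : Fin k → E) :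
    0 ≤ coulombPair x y := by
  unfold coulombPair
  have h : ∀ z : Fin k → E, 0 ≤ ∏ i, ∏ j, if i = j then 1 else ‖z i - z j‖ ^ (1 / 8 : ℝ) :=
    fun z => prod_nonneg fun i _ => prod_nonneg fun j _ => by split_ifs <;> positivity
  have := h x
  have := h y
  positivity

/-- Splitting off one point from the product over all ordered pairs of distinct points. -/
lemma prod_prod_ne_succAbove {E : Type*} [NormedAddCommGroup E] {k : ℕ} (x : Fin (k + 1) → E)
    (p : Fin (k + 1)) :
    (∏ i, ∏ j, if i = j then 1 else ‖x i - x j‖ ^ (1 / 8 : ℝ)) =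
      (∏ l, ‖x p - x (p.succAbove l)‖ ^ (1 / 4 : ℝ)) *
        ∏ i, ∏ j, if i = j then 1 else
          ‖x (p.succAbove i) - x (p.succAbove j)‖ ^ (1 / 8 : ℝ) := by
  rw [Fin.prod_univ_succAbove _ p]
  simp_rw [Fin.prod_univ_succAbove _ p]
  simp only [if_true, one_mul, Fin.succAbove_ne, (Fin.succAbove_ne _ _).symm, if_false,
    prod_mul_distrib, Fin.succAbove_right_inj, ← mul_assoc]
  congr 1
  rw [← prod_mul_distrib]
  refine prod_congr rfl fun l _ => ?_
  rw [norm_sub_rev (x (p.succAbove l)), ← Real.rpow_add_of_nonneg (norm_nonneg _) (by norm_num)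
    (by norm_num)]
  norm_num

lemma rpow_norm_sum_le {ι F : Type*} [SeminormedAddCommGroup F] (s : Finset ι) (f : ι → F) {p : ℝ}
    (hp : 0 < p) (hp1 : p ≤ 1) : ‖∑ i ∈ s, f i‖ ^ p ≤ ∑ i ∈ s, ‖f i‖ ^ p := by
  refine le_sum_of_subadditive (fun z : F => ‖z‖ ^ p) (by simp [hp.ne']) (fun a b => ?_) s f
  exact (Real.rpow_le_rpow (norm_nonneg _) (norm_add_le a b) hp.le).trans
    (Real.rpow_add_le_add_rpow (norm_nonneg _) (norm_nonneg _) hp.le hp1)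

lemma coulombPair_succ_le_complex {k : ℕ} (x y : Fin (k + 1) → ℂ) :
    coulombPair x y ≤ ∑ j : Fin (k + 1), (‖x 0 - y j‖ ^ (1 / 4 : ℝ))⁻¹ *
      coulombPair (fun i => x (Fin.succ i)) (fun i => y (j.succAbove i)) := by
  have hnonneg : 0 ≤ ∑ j : Fin (k + 1), (‖x 0 - y j‖ ^ (1 / 4 : ℝ))⁻¹ *
      coulombPair (fun i => x (Fin.succ i)) (fun i => y (j.succAbove i)) :=
    sum_nonneg fun j _ => mul_nonneg (by positivity) (coulombPair_nonneg _ _)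
  by_cases hxy : ∃ i j, x i = y j
  · obtain ⟨i, j, hij⟩ := hxy
    refine le_trans (le_of_eq ?_) hnonneg
    have : ∏ i, ∏ j, ‖x i - y j‖ ^ (1 / 4 : ℝ) = 0 :=
      prod_eq_zero (mem_univ i) (prod_eq_zero (mem_univ j) (by simp [hij]))
    rw [coulombPair, this, inv_zero, mul_zero]
  by_cases hy : Function.Injective y
  swap
  · refine le_trans (le_of_eq ?_) hnonneg
    obtain ⟨i, j, hij, hne⟩ := Function.not_injective_iff.1 hy
    have : (∏ i, ∏ j, if i = j then 1 else ‖y i - y j‖ ^ (1 / 8 : ℝ)) = 0 :=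
      prod_eq_zero (mem_univ i) (prod_eq_zero (mem_univ j) (by simp [hij, hne]))
    rw [coulombPair, this, mul_zero, zero_mul]
  push Not at hxy
  have hpos : ∀ {u v : ℂ}, u ≠ v → ‖u - v‖ ^ (1 / 4 : ℝ) ≠ 0 := fun h =>
    (Real.rpow_pos_of_pos (norm_pos_iff.2 (sub_ne_zero.2 h)) _).ne'
  have key := congrArg (fun w : ℂ => ‖w‖ ^ (1 / 4 : ℝ))
    (prod_sub_div_prod_sub_eq_sum (x 0) (fun i => x (Fin.succ i)) y hy (hxy 0))
  have key2 := key.le.trans (rpow_norm_sum_le _ _ (by norm_num) (by norm_num))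
  simp only [norm_mul, norm_div, norm_inv, norm_prod] at key2
  rw [Real.div_rpow (by positivity) (by positivity)] at key2
  simp only [← Real.finsetProd_rpow univ _ (fun _ _ => norm_nonneg _)] at key2
  set R : ℝ := (∏ i : Fin k, ∏ j, if i = j then 1 else ‖x i.succ - x j.succ‖ ^ (1 / 8 : ℝ)) *
    (∏ i, ∏ j, if i = j then 1 else ‖y i - y j‖ ^ (1 / 8 : ℝ)) *
    (∏ i : Fin k, ∏ j, ‖x i.succ - y j‖ ^ (1 / 4 : ℝ))⁻¹ with hR
  have hR0 : 0 ≤ R := by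
    refine mul_nonneg (mul_nonneg ?_ ?_) (by positivity) <;>
    exact prod_nonneg fun i _ => prod_nonneg fun j _ => by split_ifs <;> positivity
  calc coulombPair x y = (∏ i : Fin k, ‖x 0 - x i.succ‖ ^ (1 / 4 : ℝ)) /
        (∏ j, ‖x 0 - y j‖ ^ (1 / 4 : ℝ)) * R := by
        rw [coulombPair, prod_prod_ne_succAbove x 0, Fin.prod_univ_succ (fun i => ∏ j,
          ‖x i - y j‖ ^ (1 / 4 : ℝ))]
        simp only [Fin.succAbove_zero, hR, mul_inv, div_eq_mul_inv]
        ring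
    _ ≤ _ := mul_le_mul_of_nonneg_right key2 hR0
    _ = _ := by
        rw [sum_mul]
        refine sum_congr rfl fun j _ => ?_
        rw [Real.mul_rpow (by positivity) (by positivity), Real.inv_rpow (by positivity),
          Real.div_rpow (by positivity) (by positivity), mul_assoc]
        simp only [← Real.finsetProd_rpow univ _ (fun _ _ => norm_nonneg _)]
        congr 1
        rw [hR, coulombPair, prod_prod_ne_succAbove y j]
        simp_rw [Fin.prod_univ_succAbove _ j, prod_mul_distrib, fun i : Fin k =>
          norm_sub_rev (x i.succ) (y j)]
        have h1 : ∏ l, ‖y j - y (j.succAbove l)‖ ^ (1 / 4 : ℝ) ≠ 0 :=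
          prod_ne_zero_iff.2 fun l _ => hpos fun h => Fin.succAbove_ne j l (hy h).symm
        have h2 : ∏ i : Fin k, ‖y j - x i.succ‖ ^ (1 / 4 : ℝ) ≠ 0 :=
          prod_ne_zero_iff.2 fun l _ => hpos (hxy _ _).symm
        rw [mul_inv]
        field_simp

lemma coulombPair_succ_le {k : ℕ} (x y : Fin (k + 1) → EuclideanSpace ℝ (Fin 2)) :
    coulombPair x y ≤ ∑ j : Fin (k + 1), (‖x 0 - y j‖ ^ (1 / 4 : ℝ))⁻¹ *
      coulombPair (fun i => x (Fin.succ i)) (fun i => y (j.succAbove i)) := by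
  have h := coulombPair_succ_le_complex
    (fun i => Complex.orthonormalBasisOneI.repr.symm (x i))
    (fun i => Complex.orthonormalBasisOneI.repr.symm (y i))
  simpa only [coulombPair, ← map_sub, LinearIsometryEquiv.norm_map] using h

lemma measurable_ofReal_coulombPair (k : ℕ) :
    Measurable fun p : (Fin k → EuclideanSpace ℝ (Fin 2)) × (Fin k → EuclideanSpace ℝ (Fin 2)) =>
      ENNReal.ofReal (coulombPair p.1 p.2) := by
  have h : ∀ i j : Fin k, ∀ f : (Fin k → EuclideanSpace ℝ (Fin 2)) ×
      (Fin k → EuclideanSpace ℝ (Fin 2)) → (Fin k → EuclideanSpace ℝ (Fin 2)), Measurable f →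
      Measurable fun p => if i = j then 1 else ‖f p i - f p j‖ ^ (1 / 8 : ℝ) := by
    intro i j f hf
    split_ifs
    · fun_prop
    · fun_prop
  refine ENNReal.measurable_ofReal.comp (((Measurable.mul ?_ ?_)).mul ?_)
  · exact Finset.measurable_prod _ fun i _ => Finset.measurable_prod _ fun j _ =>
      h i j Prod.fst measurable_fst
  · exact Finset.measurable_prod _ fun i _ => Finset.measurable_prod _ fun j _ =>
      h i j Prod.snd measurable_snd
  · refine (Finset.measurable_prod _ fun i _ => Finset.measurable_prod _ fun j _ => ?_).inv
    fun_prop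

lemma lintegral_prod_pi_succ_mul {E : Type*} [MeasureSpace E] [SigmaFinite (volume : Measure E)]
    {k : ℕ} (i j : Fin (k + 1)) {G : E × E → ENNReal} (hG : Measurable G)
    {T : (Fin k → E) × (Fin k → E) → ENNReal} (hT : Measurable T) :
    ∫⁻ p : (Fin (k + 1) → E) × (Fin (k + 1) → E),
        G (p.1 i, p.2 j) * T (fun l => p.1 (i.succAbove l), fun l => p.2 (j.succAbove l)) =
      (∫⁻ p, G p) * ∫⁻ p, T p := by
  have hφ := (volume_preserving_piFinSuccAbove (fun _ : Fin (k + 1) => E) i).prod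
    (volume_preserving_piFinSuccAbove (fun _ : Fin (k + 1) => E) j)
  have hm : Measurable fun q : (E × (Fin k → E)) × (E × (Fin k → E)) =>
      G (q.1.1, q.2.1) * T (q.1.2, q.2.2) := by fun_prop
  refine (hφ.lintegral_comp hm).trans ?_
  rw [lintegral_prod _ hm.aemeasurable]
  have h1 : ∀ a : E × (Fin k → E), ∫⁻ b : E × (Fin k → E), G (a.1, b.1) * T (a.2, b.2) =
      (∫⁻ y, G (a.1, y)) * ∫⁻ ys, T (a.2, ys) := by
    intro a
    rw [Measure.volume_eq_prod, lintegral_prod _ (by fun_prop)]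
    exact lintegral_lintegral_mul (hG.comp measurable_prodMk_left).aemeasurable
      (hT.comp measurable_prodMk_left).aemeasurable
  simp_rw [h1]
  have hG' : Measurable fun x => ∫⁻ y, G (x, y) := hG.lintegral_prod_right'
  have hT' : Measurable fun x => ∫⁻ y, T (x, y) := hT.lintegral_prod_right'
  rw [Measure.volume_eq_prod, lintegral_prod _ (by fun_prop),
    lintegral_lintegral_mul hG'.aemeasurable hT'.aemeasurable, Measure.volume_eq_prod,
    lintegral_prod _ hG.aemeasurable, Measure.volume_eq_prod, lintegral_prod _ hT.aemeasurable]

lemma lintegral_coulombPair_le {w : EuclideanSpace ℝ (Fin 2) → ENNReal} (hw : Measurable w)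
    (k : ℕ) :
    ∫⁻ p : (Fin k → EuclideanSpace ℝ (Fin 2)) × (Fin k → EuclideanSpace ℝ (Fin 2)),
        (∏ i, w (p.1 i)) * (∏ i, w (p.2 i)) * ENNReal.ofReal (coulombPair p.1 p.2) ≤
      (k.factorial : ENNReal) * (∫⁻ p : EuclideanSpace ℝ (Fin 2) × EuclideanSpace ℝ (Fin 2),
        w p.1 * w p.2 * ENNReal.ofReal (‖p.1 - p.2‖ ^ (1 / 4 : ℝ))⁻¹) ^ k := by
  induction k with
  | zero =>
    have h1 : (volume : Measure ((Fin 0 → EuclideanSpace ℝ (Fin 2)) ×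
        (Fin 0 → EuclideanSpace ℝ (Fin 2)))) Set.univ = 1 := by
      rw [Measure.volume_eq_prod, ← Set.univ_prod_univ, Measure.prod_prod, volume_pi,
        Measure.pi_univ]
      simp
    simp [coulombPair, h1]
  | succ k ih =>
    set G : EuclideanSpace ℝ (Fin 2) × EuclideanSpace ℝ (Fin 2) → ENNReal := fun p =>
      w p.1 * w p.2 * ENNReal.ofReal (‖p.1 - p.2‖ ^ (1 / 4 : ℝ))⁻¹ with hGdef
    set T : (Fin k → EuclideanSpace ℝ (Fin 2)) × (Fin k → EuclideanSpace ℝ (Fin 2)) → ENNReal :=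
      fun p => (∏ i, w (p.1 i)) * (∏ i, w (p.2 i)) * ENNReal.ofReal (coulombPair p.1 p.2)
      with hTdef
    have hG : Measurable G := by fun_prop
    have hT : Measurable T := by
      refine Measurable.mul ?_ (measurable_ofReal_coulombPair k)
      fun_prop
    calc _ ≤ ∫⁻ p : (Fin (k + 1) → EuclideanSpace ℝ (Fin 2)) ×
            (Fin (k + 1) → EuclideanSpace ℝ (Fin 2)), ∑ j : Fin (k + 1), G (p.1 0, p.2 j) *
            T (fun l => p.1 ((0 : Fin (k + 1)).succAbove l), fun l => p.2 (j.succAbove l)) := by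
          refine lintegral_mono fun p => ?_
          refine (mul_le_mul_right (ENNReal.ofReal_le_ofReal (coulombPair_succ_le p.1 p.2)) _).trans
            (le_of_eq ?_)
          rw [ENNReal.ofReal_sum_of_nonneg fun j _ =>
            mul_nonneg (by positivity) (coulombPair_nonneg _ _), mul_sum]
          refine sum_congr rfl fun j _ => ?_
          rw [ENNReal.ofReal_mul (by positivity), Fin.prod_univ_succ,
            Fin.prod_univ_succAbove (fun i => w (p.2 i)) j]
          simp only [hGdef, hTdef, Fin.succAbove_zero]
          ring
      _ = ∑ j : Fin (k + 1), (∫⁻ p, G p) * ∫⁻ p, T p := by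
          rw [lintegral_finsetSum _ fun j _ => by fun_prop]
          exact sum_congr rfl fun j _ => lintegral_prod_pi_succ_mul 0 j hG hT
      _ ≤ ∑ j : Fin (k + 1), (∫⁻ p, G p) * ((k.factorial : ENNReal) * (∫⁻ p, G p) ^ k) := by
          gcongr
      _ = _ := by
          simp only [sum_const, card_univ, Fintype.card_fin, Nat.factorial_succ, nsmul_eq_mul]
          push_cast
          ring

lemma integrable_interaction {h : EuclideanSpace ℝ (Fin 2) → ℝ} (hmeas : Measurable h)
    (hbdd : ∃ C, ∀ x, |h x| ≤ C) (hsupp : HasCompactSupport h) :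
    Integrable (fun p : EuclideanSpace ℝ (Fin 2) × EuclideanSpace ℝ (Fin 2) =>
        |h p.1| * |h p.2| * ‖p.1 - p.2‖ ^ (-(1 / 4) : ℝ)) := by
  obtain ⟨C, hC⟩ := hbdd
  obtain ⟨R, hR⟩ := hsupp.isBounded.subset_ball 0
  have hzero : ∀ x, R ≤ ‖x‖ → h x = 0 := fun x hx => by
    by_contra hne
    have := hR (subset_tsupport h hne)
    rw [mem_ball_zero_iff] at this
    exact absurd hx (not_le.2 this)
  have hint : Integrable fun x => |h x| := by
    have h1 : IntegrableOn h (Metric.ball 0 R) :=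
      Measure.integrableOn_of_bounded (M := C) measure_ball_lt_top.ne
        hmeas.aestronglyMeasurable (ae_of_all _ fun x => hC x)
    refine ((integrableOn_iff_integrable_of_support_subset ?_).1 h1).abs
    exact (subset_tsupport h).trans hR
  have hker : IntegrableOn (fun z : EuclideanSpace ℝ (Fin 2) => ‖z‖ ^ (-(1 / 4) : ℝ))
      (Metric.ball 0 (2 * R)) := by
    refine integrableOn_ball_of_norm_le_rpow (C := 1) (α := 1 / 4) (by simp) (by norm_num)
      (ae_of_all _ fun x => ?_) (measurable_norm.pow_const _).aestronglyMeasurable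
    rw [one_mul, Real.norm_of_nonneg (by positivity)]
  have hconv := hint.convolution_integrand (ContinuousLinearMap.mul ℝ ℝ)
    ((integrable_indicator_iff measurableSet_ball).2 hker) (μ := volume) (ν := volume)
  have hprod := hconv.bdd_mul (f := fun p => |h p.1|) (c := C)
    (by simpa only [Real.norm_eq_abs, Function.comp_apply] using
      (hmeas.comp measurable_fst).norm.aestronglyMeasurable)
    (ae_of_all _ fun p => by simpa using hC p.1)
  refine hprod.congr (ae_of_all _ fun p => ?_)
  simp only [ContinuousLinearMap.mul_apply', ← mul_assoc]
  by_cases hp : p.1 - p.2 ∈ Metric.ball (0 : EuclideanSpace ℝ (Fin 2)) (2 * R)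
  · rw [Set.indicator_of_mem hp]
  · rw [Set.indicator_of_notMem hp]
    rw [mem_ball_zero_iff, not_lt] at hp
    have := norm_sub_le p.1 p.2
    rcases le_total R ‖p.1‖ with h1 | h1
    · simp [hzero _ h1]
    · simp [hzero p.2 (by linarith)]

lemma prod_prod_ite_eq_prod_Ioi_sq {n : ℕ} {M : Type*} [CommMonoid M] (g : Fin n → Fin n → M)
    (hg : ∀ i j, g i j = g j i) :
    (∏ i, ∏ j, if i = j then 1 else g i j) = ∏ i, ∏ j ∈ Ioi i, g i j ^ 2 := by
  have h1 : ∀ i, (∏ j, if i = j then 1 else g i j) =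
      (∏ j ∈ Ioi i, g i j) * ∏ j ∈ Iio i, g i j := by
    intro i
    have hd : Disjoint (Ioi i) (Iio i) :=
      disjoint_left.2 fun j hj hj' => lt_asymm (mem_Ioi.1 hj) (mem_Iio.1 hj')
    rw [← prod_union hd]
    have hs : Ioi i ∪ Iio i ⊆ univ := subset_univ _
    rw [← prod_subset hs]
    · refine prod_congr rfl fun j hj => if_neg ?_
      rintro rfl
      simp at hj
    · intro j _ hj
      simp only [mem_union, mem_Ioi, mem_Iio, not_or, not_lt] at hj
      exact if_pos (le_antisymm hj.2 hj.1)
  have h2 : ∏ i, ∏ j ∈ Iio i, g i j = ∏ i, ∏ j ∈ Ioi i, g i j := by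
    rw [prod_comm' (t' := univ) (s' := fun j => Ioi j) (by simp)]
    exact prod_congr rfl fun i _ => prod_congr rfl fun j _ => hg j i
  simp_rw [h1, prod_mul_distrib, h2, ← prod_mul_distrib, sq]

/-- A neutral configuration of `2k` charges has `k` charges of each sign. -/
lemma exists_equiv_of_neutral {k : ℕ} {ξ : Fin (2 * k) → ℤ} (hξ : ∀ i, ξ i = -1 ∨ ξ i = 1)
    (hsum : ∑ i, ξ i = 0) :
    #{i | ξ i = 1} = k ∧ ∃ e : Fin k ⊕ Fin k ≃ Fin (2 * k),
      (∀ i, ξ (e (Sum.inl i)) = 1) ∧ ∀ i, ξ (e (Sum.inr i)) = -1 := by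
  have h1 : #{i | ξ i = 1} + #{i | ¬ ξ i = 1} = 2 * k := by
    rw [card_filter_add_card_filter_not, card_univ, Fintype.card_fin]
  have h2 : (#{i | ξ i = 1} : ℤ) - #{i | ¬ ξ i = 1} = 0 := by
    rw [← hsum, card_filter, card_filter]
    push_cast
    rw [← sum_sub_distrib]
    refine sum_congr rfl fun i _ => ?_
    rcases hξ i with h | h <;> simp [h]
  have hp : #{i | ξ i = 1} = k := by omega
  have hn : #{i | ¬ ξ i = 1} = k := by omega
  refine ⟨hp, ?_⟩
  have e1 : Fin k ≃ {i // ξ i = 1} := Fintype.equivOfCardEq (by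
    rw [Fintype.card_fin, Fintype.card_subtype, hp])
  have e2 : Fin k ≃ {i // ¬ ξ i = 1} := Fintype.equivOfCardEq (by
    rw [Fintype.card_fin, Fintype.card_subtype, hn])
  refine ⟨(Equiv.sumCongr e1 e2).trans (Equiv.sumCompl _), fun i => ?_, fun i => ?_⟩
  · simpa using (e1 i).2
  · simpa using (hξ _).resolve_right (e2 i).2

lemma prod_Ioi_eq_coulombPair {E : Type*} [NormedAddCommGroup E] {k : ℕ} {ξ : Fin (2 * k) → ℤ}
    (e : Fin k ⊕ Fin k ≃ Fin (2 * k)) (hl : ∀ i, ξ (e (Sum.inl i)) = 1)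
    (hr : ∀ i, ξ (e (Sum.inr i)) = -1) (x : Fin (2 * k) → E) :
    ∏ i, ∏ j ∈ Ioi i, ‖x i - x j‖ ^ (((ξ i * ξ j : ℤ) : ℝ) / 4) =
      coulombPair (fun i => x (e (Sum.inl i))) (fun i => x (e (Sum.inr i))) := by
  have h1 : ∀ i j, ‖x i - x j‖ ^ (((ξ i * ξ j : ℤ) : ℝ) / 4) =
      (‖x i - x j‖ ^ (((ξ i * ξ j : ℤ) : ℝ) / 8)) ^ 2 := by
    intro i j
    rw [← Real.rpow_natCast, ← Real.rpow_mul (norm_nonneg _)]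
    congr 1
    push_cast
    ring
  simp_rw [h1]
  rw [← prod_prod_ite_eq_prod_Ioi_sq _ fun i j => by rw [norm_sub_rev, mul_comm],
    ← e.prod_comp]
  simp_rw [← e.prod_comp (fun j => if _ = j then (1 : ℝ) else _), Fintype.prod_sum_type,
    e.apply_eq_iff_eq, prod_mul_distrib, hl, hr]
  simp only [Sum.inl.injEq, Sum.inr.injEq, reduceCtorEq, if_false, coulombPair]
  have h2 : ∏ i : Fin k, ∏ j : Fin k, ‖x (e (Sum.inr i)) - x (e (Sum.inl j))‖ ^
      (((-1 * 1 : ℤ) : ℝ) / 8) = ∏ i : Fin k, ∏ j : Fin k,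
        ‖x (e (Sum.inl i)) - x (e (Sum.inr j))‖ ^ (((1 * -1 : ℤ) : ℝ) / 8) := by
    rw [prod_comm]
    refine prod_congr rfl fun i _ => prod_congr rfl fun j _ => ?_
    rw [norm_sub_rev, mul_comm (1 : ℤ)]
  have h3 : (∏ i : Fin k, ∏ j : Fin k, ‖x (e (Sum.inl i)) - x (e (Sum.inr j))‖ ^ (1 / 4 : ℝ))⁻¹ =
      (∏ i : Fin k, ∏ j : Fin k,
        ‖x (e (Sum.inl i)) - x (e (Sum.inr j))‖ ^ (((1 * -1 : ℤ) : ℝ) / 8)) ^ 2 := by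
    simp_rw [← prod_inv_distrib, ← prod_pow]
    refine prod_congr rfl fun i _ => prod_congr rfl fun j _ => ?_
    rw [← Real.rpow_natCast, ← Real.rpow_mul (norm_nonneg _), ← Real.rpow_neg (norm_nonneg _)]
    norm_num
  rw [h2, h3]
  norm_num
  ring

lemma measurePreserving_comp_sum {E : Type*} [MeasureSpace E] [SigmaFinite (volume : Measure E)]
    {k n : ℕ} (e : Fin k ⊕ Fin k ≃ Fin n) :
    MeasurePreserving (fun x : Fin n → E =>
      ((fun i => x (e (Sum.inl i))), (fun i => x (e (Sum.inr i))))) :=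
  (volume_measurePreserving_sumPiEquivProdPi (fun _ : Fin k ⊕ Fin k => E)).comp
    ((volume_measurePreserving_piCongrLeft (fun _ : Fin n => E) e).symm)

lemma card_neutral_le (k : ℕ) :
    #{ξ ∈ Fintype.piFinset fun _ : Fin (2 * k) => ({-1, 1} : Finset ℤ) | ∑ i, ξ i = 0} ≤
      (2 * k).choose k := by
  have hmem : ∀ ξ ∈ {ξ ∈ Fintype.piFinset fun _ : Fin (2 * k) => ({-1, 1} : Finset ℤ) |
      ∑ i, ξ i = 0}, (∀ i, ξ i = -1 ∨ ξ i = 1) ∧ ∑ i, ξ i = 0 := by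
    intro ξ hξ
    simpa [Fintype.mem_piFinset] using hξ
  have hcard : #(powersetCard k (univ : Finset (Fin (2 * k)))) = (2 * k).choose k := by
    rw [card_powersetCard, card_univ, Fintype.card_fin]
  rw [← hcard]
  refine card_le_card_of_injOn (fun ξ => ({i | ξ i = 1} : Finset (Fin (2 * k)))) ?_ ?_
  · intro ξ hξ
    obtain ⟨h1, h2⟩ := hmem ξ hξ
    simpa [mem_powersetCard] using (exists_equiv_of_neutral h1 h2).1
  · intro ξ hξ η hη heq
    have h1 := (hmem ξ hξ).1
    have h2 := (hmem η hη).1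
    funext i
    have h3 := Finset.ext_iff.1 heq i
    simp only [mem_filter, mem_univ, true_and] at h3
    rcases h1 i with h | h <;> rcases h2 i with h' | h' <;> simp_all

lemma enorm_momentM_le {h : EuclideanSpace ℝ (Fin 2) → ℝ} (hmeas : Measurable h) (k : ℕ) :
    ‖momentM (2 * k) h‖ₑ ≤ ((2 * k).choose k : ENNReal) * ((k.factorial : ENNReal) *
      (∫⁻ p : EuclideanSpace ℝ (Fin 2) × EuclideanSpace ℝ (Fin 2),
        ‖h p.1‖ₑ * ‖h p.2‖ₑ * ENNReal.ofReal (‖p.1 - p.2‖ ^ (1 / 4 : ℝ))⁻¹) ^ k) := by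
  set S := {ξ ∈ Fintype.piFinset fun _ : Fin (2 * k) => ({-1, 1} : Finset ℤ) | ∑ i, ξ i = 0}
    with hS
  set V : (Fin (2 * k) → ℤ) → (Fin (2 * k) → EuclideanSpace ℝ (Fin 2)) → ℝ := fun ξ x =>
    ∏ i, ∏ j ∈ Finset.Ioi i, ‖x i - x j‖ ^ (((ξ i * ξ j : ℤ) : ℝ) / 4) with hV
  have hV0 : ∀ ξ x, 0 ≤ V ξ x := fun ξ x =>
    prod_nonneg fun i _ => prod_nonneg fun j _ => by positivity
  have hw : Measurable fun x => ‖h x‖ₑ := hmeas.enorm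
  calc ‖momentM (2 * k) h‖ₑ ≤ ∫⁻ x : Fin (2 * k) → EuclideanSpace ℝ (Fin 2),
          ‖(∏ ℓ, h (x ℓ)) * coulomb (2 * k) x‖ₑ := enorm_integral_le_lintegral_enorm _
    _ = ∫⁻ x : Fin (2 * k) → EuclideanSpace ℝ (Fin 2),
          ∑ ξ ∈ S, (∏ i, ‖h (x i)‖ₑ) * ENNReal.ofReal (V ξ x) := by
        refine lintegral_congr fun x => ?_
        have h0 : 0 ≤ coulomb (2 * k) x := sum_nonneg fun ξ _ => hV0 ξ x
        rw [enorm_mul, Real.enorm_of_nonneg h0, ← mul_sum,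
          ← ENNReal.ofReal_sum_of_nonneg fun ξ _ => hV0 ξ x]
        congr 1
        simp only [enorm_eq_nnnorm, nnnorm_prod, ENNReal.ofNNReal_finsetProd]
    _ = ∑ ξ ∈ S, ∫⁻ x : Fin (2 * k) → EuclideanSpace ℝ (Fin 2),
          (∏ i, ‖h (x i)‖ₑ) * ENNReal.ofReal (V ξ x) := by
        refine lintegral_finsetSum _ fun ξ _ => Measurable.mul (by fun_prop) ?_
        refine ENNReal.measurable_ofReal.comp (Finset.measurable_prod _ fun i _ =>
          Finset.measurable_prod _ fun j _ => Measurable.pow_const (by fun_prop) _)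
    _ ≤ ∑ ξ ∈ S, ((k.factorial : ENNReal) *
      (∫⁻ p : EuclideanSpace ℝ (Fin 2) × EuclideanSpace ℝ (Fin 2),
        ‖h p.1‖ₑ * ‖h p.2‖ₑ * ENNReal.ofReal (‖p.1 - p.2‖ ^ (1 / 4 : ℝ))⁻¹) ^ k) := by
        refine sum_le_sum fun ξ hξ => ?_
        have hξ' : (∀ i, ξ i = -1 ∨ ξ i = 1) ∧ ∑ i, ξ i = 0 := by
          simpa [hS, Fintype.mem_piFinset] using hξ
        obtain ⟨-, e, hl, hr⟩ := exists_equiv_of_neutral hξ'.1 hξ'.2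
        refine le_trans (le_of_eq ?_) (lintegral_coulombPair_le hw k)
        have hm : Measurable fun p : (Fin k → EuclideanSpace ℝ (Fin 2)) ×
            (Fin k → EuclideanSpace ℝ (Fin 2)) => (∏ i, ‖h (p.1 i)‖ₑ) * (∏ i, ‖h (p.2 i)‖ₑ) *
              ENNReal.ofReal (coulombPair p.1 p.2) :=
          Measurable.mul (by fun_prop) (measurable_ofReal_coulombPair k)
        rw [← (measurePreserving_comp_sum e).lintegral_comp hm]
        refine lintegral_congr fun x => ?_
        rw [hV]
        simp only [prod_Ioi_eq_coulombPair e hl hr x]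
        rw [← e.prod_comp, Fintype.prod_sum_type]
    _ ≤ _ := by
        rw [sum_const, nsmul_eq_mul]
        gcongr
        exact card_neutral_le k

/-- For bounded, measurable, compactly supported `h : ℝ² → ℝ`: the kernel
`|h(x)||h(y)||x−y|^{−1/4}` is integrable (i.e. `B_h < ∞`); for every `k`,
`|M_{2k}(h)| ≤ ((2k)!/k!) B_h^k`; consequently there is `A_h > 0` with
`|M_{2k}(h)| ≤ A_h^{2k} (2k)!` for every `k`. -/
theorem stmt14 (h : EuclideanSpace ℝ (Fin 2) → ℝ)
    (hmeas : Measurable h) (hbdd : ∃ C, ∀ x, |h x| ≤ C)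
    (hsupp : HasCompactSupport h) :
    Integrable (fun p : EuclideanSpace ℝ (Fin 2) × EuclideanSpace ℝ (Fin 2) =>
        |h p.1| * |h p.2| * ‖p.1 - p.2‖ ^ (-(1 / 4) : ℝ)) ∧
    (∀ k : ℕ,
      |momentM (2 * k) h| ≤
        (((2 * k).factorial : ℝ) / (k.factorial : ℝ)) *
          (∫ x : EuclideanSpace ℝ (Fin 2), ∫ y : EuclideanSpace ℝ (Fin 2),
            |h x| * |h y| * ‖x - y‖ ^ (-(1 / 4) : ℝ)) ^ k) ∧
    ∃ A : ℝ, 0 < A ∧ ∀ k : ℕ,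
      |momentM (2 * k) h| ≤ A ^ (2 * k) * ((2 * k).factorial : ℝ) := by
  have hint := integrable_interaction hmeas hbdd hsupp
  set B : ℝ := ∫ x : EuclideanSpace ℝ (Fin 2), ∫ y : EuclideanSpace ℝ (Fin 2),
    |h x| * |h y| * ‖x - y‖ ^ (-(1 / 4) : ℝ) with hB
  have hB0 : 0 ≤ B := integral_nonneg fun x => integral_nonneg fun y => by positivity
  have hBl : ∫⁻ p : EuclideanSpace ℝ (Fin 2) × EuclideanSpace ℝ (Fin 2),
      ‖h p.1‖ₑ * ‖h p.2‖ₑ * ENNReal.ofReal (‖p.1 - p.2‖ ^ (1 / 4 : ℝ))⁻¹ = ENNReal.ofReal B := by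
    have h1 : B = ∫ p : EuclideanSpace ℝ (Fin 2) × EuclideanSpace ℝ (Fin 2),
        |h p.1| * |h p.2| * ‖p.1 - p.2‖ ^ (-(1 / 4) : ℝ) := (integral_prod _ hint).symm
    rw [h1, ofReal_integral_eq_lintegral_ofReal hint (ae_of_all _ fun p => by positivity)]
    refine lintegral_congr fun p => ?_
    rw [ENNReal.ofReal_mul (by positivity), ENNReal.ofReal_mul (by positivity),
      Real.rpow_neg (norm_nonneg _), ← Real.enorm_eq_ofReal_abs, ← Real.enorm_eq_ofReal_abs]
  have hbound : ∀ k : ℕ, |momentM (2 * k) h| ≤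
      (((2 * k).factorial : ℝ) / (k.factorial : ℝ)) * B ^ k := by
    intro k
    have h1 := enorm_momentM_le hmeas k
    rw [hBl, Real.enorm_eq_ofReal_abs, ← ENNReal.ofReal_pow hB0, ← ENNReal.ofReal_natCast,
      ← ENNReal.ofReal_natCast, ← ENNReal.ofReal_mul (by positivity),
      ← ENNReal.ofReal_mul (by positivity), ENNReal.ofReal_le_ofReal_iff (by positivity),
      ← mul_assoc] at h1
    refine h1.trans (le_of_eq ?_)
    congr 1
    rw [Nat.cast_choose ℝ (by omega : k ≤ 2 * k), show 2 * k - k = k by omega]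
    field_simp
  refine ⟨hint, hbound, B + 1, by positivity, fun k => (hbound k).trans ?_⟩
  rw [mul_comm]
  have hfac : (1 : ℝ) ≤ k.factorial := by exact_mod_cast k.factorial_pos
  refine mul_le_mul ?_ (div_le_self (by positivity) hfac) (by positivity) (by positivity)
  calc B ^ k ≤ (B + 1) ^ k := by gcongr; linarith
    _ ≤ (B + 1) ^ (2 * k) := pow_le_pow_right₀ (by linarith) (by omega)
end

section
/- Let n ∈ 2ℕ and let h : ℝ² → ℝ be bounded, measurable, and compactly supported. Then the function (x₁,…,x_n) ↦ h(x₁)⋯h(x_n) ⟨x₁,…,x_n⟩ is Lebesgue integrable on (ℝ²)^n; in particular M_n(h) is well-defined and finite. -/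
open MeasureTheory Finset

theorem Matrix.det_prod_erase_sub_mul_det_vandermonde {K : Type*} [Field K] {m : ℕ}
    (x y : Fin m → K) :
    (Matrix.of fun i j => ∏ k ∈ univ.erase j, (x i - y k)).det * (Matrix.vandermonde y).det =
      (Matrix.vandermonde x).det * ∏ j, ∏ k ∈ univ.erase j, (y j - y k) := by
  set p : Fin m → Polynomial K :=
    fun j => ∏ k ∈ univ.erase j, (Polynomial.X - Polynomial.C (y k)) with hp
  have hdeg (j : Fin m) : (p j).natDegree < m := by
    rw [hp, Polynomial.natDegree_finsetProd_X_sub_C_eq_card, Finset.card_erase_of_mem (mem_univ j)]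
    have := j.pos
    simp; omega
  have key (v : Fin m → K) : (Matrix.of fun i j => ∏ k ∈ univ.erase j, (v i - y k)) =
      Matrix.vandermonde v * Matrix.of fun i j : Fin m => (p j).coeff i := by
    ext i j
    have h1 : ∏ k ∈ univ.erase j, (v i - y k) = (p j).eval (v i) := by
      simp [hp, Polynomial.eval_prod]
    rw [Matrix.of_apply, h1, Polynomial.eval_eq_sum_range' (hdeg j), Matrix.mul_apply,
      Finset.sum_range]
    exact Finset.sum_congr rfl fun k _ => by simp [mul_comm]
  have hdiag : (Matrix.of fun i j => ∏ k ∈ univ.erase j, (y i - y k)) =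
      Matrix.diagonal fun j => ∏ k ∈ univ.erase j, (y j - y k) := by
    ext i j
    rcases eq_or_ne i j with rfl | hij
    · simp
    · rw [Matrix.diagonal_apply_ne _ hij, Matrix.of_apply]
      exact Finset.prod_eq_zero (mem_erase.2 ⟨hij, mem_univ i⟩) (sub_self _)
  have hy := congrArg Matrix.det (key y)
  rw [hdiag, Matrix.det_diagonal, Matrix.det_mul] at hy
  rw [hy, key x, Matrix.det_mul]
  ring

theorem Finset.prod_prod_Ioi_sq {M : Type*} [CommMonoid M] {m : ℕ} {f : Fin m → Fin m → M}
    (hf : ∀ i j, f i j = f j i) :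
    (∏ i, ∏ j ∈ Ioi i, f i j) ^ 2 = ∏ i, ∏ j ∈ univ.erase i, f i j := by
  have h := prod_prod_Ioi_mul_eq_prod_prod_off_diag f
  simp_rw [fun i j => hf j i, prod_mul_distrib] at h
  rw [sq, h]
  refine prod_congr rfl fun i _ => prod_congr ?_ fun _ _ => rfl
  ext; simp

theorem norm_det_vandermonde_mul_le {𝕜 : Type*} [NormedField 𝕜] {m : ℕ} (x y : Fin m → 𝕜) :
    (∏ i, ∏ j ∈ Ioi i, ‖x i - x j‖) * (∏ i, ∏ j ∈ Ioi i, ‖y i - y j‖) ≤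
      ∑ σ : Equiv.Perm (Fin m), ∏ i, ∏ k ∈ univ.erase (σ i), ‖x i - y k‖ := by
  have hV (v : Fin m → 𝕜) : ‖(Matrix.vandermonde v).det‖ = ∏ i, ∏ j ∈ Ioi i, ‖v i - v j‖ := by
    simp only [Matrix.det_vandermonde, norm_prod, norm_sub_rev]
  rw [← hV x, ← hV y]
  by_cases h0 : (Matrix.vandermonde y).det = 0
  · rw [h0, norm_zero, mul_zero]
    positivity
  have h := congrArg norm (Matrix.det_prod_erase_sub_mul_det_vandermonde x y)
  simp only [norm_mul, norm_prod] at h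
  rw [← prod_prod_Ioi_sq (fun i j => norm_sub_rev (y i) (y j)), ← hV y, sq, ← mul_assoc] at h
  rw [← mul_right_cancel₀ (norm_ne_zero_iff.2 h0) h, ← Matrix.det_transpose, Matrix.det_apply]
  refine (norm_sum_le _ _).trans (sum_le_sum fun σ _ => ?_)
  rcases Int.units_eq_one_or (Equiv.Perm.sign σ) with hs | hs <;> simp [hs, norm_prod]

theorem Real.rpow_sum_le_sum_rpow_of_le_one {ι : Type*} (s : Finset ι) {f : ι → ℝ} {p : ℝ}
    (hp : 0 < p) (hp1 : p ≤ 1) (hf : ∀ i ∈ s, 0 ≤ f i) :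
    (∑ i ∈ s, f i) ^ p ≤ ∑ i ∈ s, f i ^ p :=
  le_sum_of_subadditive_on_pred (fun t : ℝ => t ^ p) (fun t => 0 ≤ t)
    (by simp [Real.zero_rpow hp.ne']) (fun _ _ ha hb => Real.rpow_add_le_add_rpow ha hb hp.le hp1)
    (fun _ _ => add_nonneg) f hf

theorem prod_norm_sub_rpow_mul_le_sum_perm {m : ℕ} (x y : Fin m → EuclideanSpace ℝ (Fin 2))
    {s : ℝ} (hs : 0 < s) (hs1 : s ≤ 1) :
    (∏ i, ∏ j ∈ Ioi i, ‖x i - x j‖ ^ s) * (∏ i, ∏ j ∈ Ioi i, ‖y i - y j‖ ^ s) *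
      (∏ i, ∏ j, ‖x i - y j‖ ^ (-s)) ≤
      ∑ σ : Equiv.Perm (Fin m), ∏ i, ‖x i - y (σ i)‖ ^ (-s) := by
  by_cases hxy : ∃ i j, x i = y j
  · obtain ⟨i, j, hij⟩ := hxy
    have h0 : ∏ i, ∏ j, ‖x i - y j‖ ^ (-s) = 0 :=
      prod_eq_zero (mem_univ i) (prod_eq_zero (mem_univ j)
        (by simp [hij, Real.zero_rpow (neg_ne_zero.2 hs.ne')]))
    rw [h0, mul_zero]
    positivity
  push Not at hxy
  let φ := Complex.orthonormalBasisOneI.repr.symm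
  have hφ (a b : EuclideanSpace ℝ (Fin 2)) : ‖φ a - φ b‖ = ‖a - b‖ := by
    rw [← map_sub, LinearIsometryEquiv.norm_map]
  have h := norm_det_vandermonde_mul_le (φ ∘ x) (φ ∘ y)
  simp only [Function.comp_apply, hφ] at h
  have hpow := (Real.rpow_le_rpow (by positivity) h hs.le).trans
    (Real.rpow_sum_le_sum_rpow_of_le_one _ hs hs1 fun σ _ => by positivity)
  rw [Real.mul_rpow (by positivity) (by positivity)] at hpow
  simp (disch := intros; positivity) only [← Real.finsetProd_rpow] at hpow
  refine (mul_le_mul_of_nonneg_right hpow (by positivity)).trans_eq ?_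
  rw [sum_mul]
  refine sum_congr rfl fun σ _ => ?_
  rw [← prod_mul_distrib]
  refine prod_congr rfl fun i _ => ?_
  rw [← mul_prod_erase univ (fun j => ‖x i - y j‖ ^ (-s)) (mem_univ (σ i)), mul_left_comm,
    ← prod_mul_distrib, prod_eq_one, mul_one]
  intro j _
  rw [← Real.rpow_add (norm_pos_iff.2 (sub_ne_zero.2 (hxy i j))), add_neg_cancel, Real.rpow_zero]

theorem MeasureTheory.Integrable.prod_pairs {E : Type*} [MeasureSpace E]
    [SigmaFinite (volume : Measure E)] {ι κ : Type*} [Fintype ι] [Fintype κ] (e : κ ⊕ κ ≃ ι)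
    {f : E × E → ℝ} (hf : Integrable f) :
    Integrable fun z : ι → E => ∏ a, f (z (e (.inl a)), z (e (.inr a))) := by
  have h1 := (volume_measurePreserving_arrowProdEquivProdArrow E E κ).symm
  have h2 := volume_measurePreserving_sumPiEquivProdPi fun _ : κ ⊕ κ => E
  have h3 := (volume_measurePreserving_piCongrLeft (fun _ : ι => E) e).symm
  have hF : Integrable fun w : κ → E × E => ∏ a, f (w a) := .fintype_prod fun _ => hf
  exact (h1.comp (h2.comp h3)).integrable_comp_of_integrable hF

theorem integrable_mul_mul_norm_sub_rpow {E : Type*} [NormedAddCommGroup E] [NormedSpace ℝ E]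
    [FiniteDimensional ℝ E] [MeasureSpace E] [BorelSpace E]
    [(volume : Measure E).IsAddHaarMeasure] {h : E → ℝ}
    (hmeas : Measurable h) (hbdd : ∃ C, ∀ x, |h x| ≤ C) (hsupp : HasCompactSupport h) {s : ℝ}
    (hd : 1 ≤ Module.finrank ℝ E) (hs : s < Module.finrank ℝ E) :
    Integrable fun p : E × E => h p.1 * h p.2 * ‖p.1 - p.2‖ ^ (-s) := by
  obtain ⟨C, hC⟩ := hbdd
  obtain ⟨R, hR⟩ := hsupp.isCompact.isBounded.subset_ball 0
  have hzero (x : E) (hx : R ≤ ‖x‖) : h x = 0 :=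
    image_eq_zero_of_notMem_tsupport fun hx' => (mem_ball_zero_iff.1 (hR hx')).not_ge hx
  have hh : Integrable h := by
    refine IntegrableOn.integrable_of_forall_notMem_eq_zero (s := Metric.ball 0 R) ?_ fun x hx =>
      hzero x (by simpa using hx)
    exact Measure.integrableOn_of_bounded measure_ball_lt_top.ne hmeas.aestronglyMeasurable
      (ae_of_all _ hC)
  have hk : Integrable ((Metric.ball (0 : E) (2 * R)).indicator fun x => ‖x‖ ^ (-s)) := by
    rw [integrable_indicator_iff Metric.isOpen_ball.measurableSet]
    refine integrableOn_ball_of_norm_le_rpow (C := 1) hd hs (ae_of_all _ fun x => ?_) ?_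
    · rw [one_mul, Real.norm_of_nonneg (by positivity)]
    · exact (measurable_norm.pow_const _).aestronglyMeasurable
  have hconv := (hh.convolution_integrand (ContinuousLinearMap.mul ℝ ℝ) hk).norm.const_mul C
  refine hconv.mono' (by fun_prop) (ae_of_all _ fun p => ?_)
  rw [ContinuousLinearMap.mul_apply', norm_mul, norm_mul, norm_mul, mul_assoc]
  by_cases hp : ‖p.1‖ < R ∧ ‖p.2‖ < R
  · rw [Set.indicator_of_mem]
    · exact mul_le_mul_of_nonneg_right (hC _) (by positivity)
    · rw [mem_ball_zero_iff]
      linarith [norm_sub_le p.1 p.2]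
  · have : ‖h p.1‖ * (‖h p.2‖ * ‖‖p.1 - p.2‖ ^ (-s)‖) = 0 := by
      rw [not_and_or, not_lt, not_lt] at hp
      rcases hp with hp | hp <;> simp [hzero _ hp]
    rw [this]
    have := (abs_nonneg _).trans (hC 0)
    positivity

theorem prod_prod_Ioi_eq_of_sum_equiv {m n : ℕ} (e : Fin m ⊕ Fin m ≃ Fin n)
    {f : Fin n → Fin n → ℝ} (hf : ∀ i j, f i j = f j i) (hf0 : ∀ i j, 0 ≤ f i j) :
    ∏ i, ∏ j ∈ Ioi i, f i j =
      (∏ a, ∏ b ∈ Ioi a, f (e (.inl a)) (e (.inl b))) *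
      (∏ a, ∏ b ∈ Ioi a, f (e (.inr a)) (e (.inr b))) *
      ∏ a, ∏ b, f (e (.inl a)) (e (.inr b)) := by
  have key {k : ℕ} (g : Fin k → Fin k → ℝ) (i : Fin k) :
      ∏ j ∈ univ.erase i, g i j = ∏ j, if j = i then 1 else g i j := by
    rw [← mul_prod_erase univ (fun j => if j = i then 1 else g i j) (mem_univ i), if_pos rfl,
      one_mul]
    exact prod_congr rfl fun j hj => (if_neg (ne_of_mem_erase hj)).symm
  have hnn {k : ℕ} (g : Fin k → Fin n) : 0 ≤ ∏ a, ∏ b ∈ Ioi a, f (g a) (g b) :=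
    prod_nonneg fun a _ => prod_nonneg fun b _ => hf0 _ _
  refine (sq_eq_sq₀ (hnn id) (mul_nonneg (mul_nonneg (hnn fun a => e (.inl a))
    (hnn fun a => e (.inr a))) (prod_nonneg fun a _ => prod_nonneg fun b _ => hf0 _ _))).1 ?_
  have hsplit : ∏ i, ∏ j, (if j = i then 1 else f i j) =
      (∏ a, ∏ b, (if b = a then 1 else f (e (.inl a)) (e (.inl b)))) *
      (∏ a, ∏ b, (if b = a then 1 else f (e (.inr a)) (e (.inr b)))) *
      (∏ a, ∏ b, f (e (.inl a)) (e (.inr b))) ^ 2 := by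
    have hswap : ∏ a, ∏ b, f (e (.inr a)) (e (.inl b)) = ∏ a, ∏ b, f (e (.inl a)) (e (.inr b)) :=
      prod_comm.trans (prod_congr rfl fun a _ => prod_congr rfl fun b _ => hf _ _)
    simp_rw [← e.prod_comp, Fintype.prod_sum_type, prod_mul_distrib, EmbeddingLike.apply_eq_iff_eq,
      Sum.inl.injEq, Sum.inr.injEq, reduceCtorEq, if_false, hswap]
    ring
  simp only [id]
  rw [mul_pow, mul_pow, prod_prod_Ioi_sq hf,
    prod_prod_Ioi_sq (f := fun a b => f (e (.inl a)) (e (.inl b))) fun a b => hf _ _,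
    prod_prod_Ioi_sq (f := fun a b => f (e (.inr a)) (e (.inr b))) fun a b => hf _ _]
  simp only [key f, key fun a b => f (e (.inl a)) (e (.inl b)),
    key fun a b => f (e (.inr a)) (e (.inr b)), hsplit]

theorem exists_sum_equiv_of_sum_eq_zero {n : ℕ} {ξ : Fin n → ℤ} (hξ : ∀ i, ξ i = -1 ∨ ξ i = 1)
    (hsum : ∑ i, ξ i = 0) :
    ∃ (m : ℕ) (e : Fin m ⊕ Fin m ≃ Fin n),
      (∀ a, ξ (e (.inl a)) = 1) ∧ ∀ a, ξ (e (.inr a)) = -1 := by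
  have hneg (i : {i // ¬ ξ i = 1}) : ξ i = -1 := (hξ i).resolve_right i.2
  have hcard : Fintype.card {i // ¬ ξ i = 1} = Fintype.card {i // ξ i = 1} := by
    rw [← (Equiv.sumCompl fun i => ξ i = 1).sum_comp, Fintype.sum_sum_type] at hsum
    simp only [Equiv.sumCompl_apply_inl, Equiv.sumCompl_apply_inr, hneg,
      fun i : {i // ξ i = 1} => i.2, sum_const, card_univ, nsmul_eq_mul] at hsum
    omega
  exact ⟨_, ((Fintype.equivFin _).symm.sumCongr (Fintype.equivFinOfCardEq hcard).symm).trans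
    (Equiv.sumCompl fun i => ξ i = 1), fun a => ((Fintype.equivFin _).symm a).2,
    fun a => hneg ((Fintype.equivFinOfCardEq hcard).symm a)⟩

theorem prod_norm_sub_rpow_le {m n : ℕ} (e : Fin m ⊕ Fin m ≃ Fin n) {ξ : Fin n → ℤ}
    (hpos : ∀ a, ξ (e (.inl a)) = 1) (hneg : ∀ a, ξ (e (.inr a)) = -1)
    (x : Fin n → EuclideanSpace ℝ (Fin 2)) :
    ∏ i, ∏ j ∈ Ioi i, ‖x i - x j‖ ^ (((ξ i * ξ j : ℤ) : ℝ) / 4) ≤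
      ∑ σ : Equiv.Perm (Fin m), ∏ a, ‖x (e (.inl a)) - x (e (.inr (σ a)))‖ ^ (-(1 / 4) : ℝ) := by
  rw [prod_prod_Ioi_eq_of_sum_equiv e (fun i j => by rw [norm_sub_rev, mul_comm])
    fun i j => by positivity]
  simp only [hpos, hneg]
  norm_num only [Int.cast_one, Int.cast_neg]
  have h := prod_norm_sub_rpow_mul_le_sum_perm (fun a => x (e (.inl a))) (fun a => x (e (.inr a)))
    (s := 1 / 4) (by norm_num) (by norm_num)
  norm_num only at h ⊢
  exact h

/-- For `n ∈ 2ℕ` and `h : ℝ² → ℝ` bounded, measurable and compactly supported, the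
function `(x₁,…,x_n) ↦ h(x₁)⋯h(x_n) ⟨x₁,…,x_n⟩` is Lebesgue integrable on `(ℝ²)^n`;
in particular `M_n(h)` is well-defined and finite. -/
theorem stmt15 (n : ℕ) (hn : Even n) (hn0 : 0 < n)
    (h : EuclideanSpace ℝ (Fin 2) → ℝ)
    (hmeas : Measurable h) (hbdd : ∃ C, ∀ x, |h x| ≤ C)
    (hsupp : HasCompactSupport h) :
    Integrable (fun x : Fin n → EuclideanSpace ℝ (Fin 2) =>
      (∏ ℓ, h (x ℓ)) * coulomb n x) := by
  have hpair : Integrable fun p : EuclideanSpace ℝ (Fin 2) × EuclideanSpace ℝ (Fin 2) =>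
      h p.1 * h p.2 * ‖p.1 - p.2‖ ^ (-(1 / 4) : ℝ) :=
    integrable_mul_mul_norm_sub_rpow hmeas hbdd hsupp (by simp) (by simp; norm_num)
  simp only [coulomb, mul_sum]
  refine integrable_finsetSum _ fun ξ hξ => ?_
  simp only [mem_filter, Fintype.mem_piFinset, mem_insert, mem_singleton] at hξ
  obtain ⟨m, e, hpos, hneg⟩ := exists_sum_equiv_of_sum_eq_zero hξ.1 hξ.2
  refine (integrable_finsetSum (univ : Finset (Equiv.Perm (Fin m))) fun σ _ =>
    (hpair.prod_pairs (((Equiv.refl _).sumCongr σ).trans e)).norm).mono'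
    (Measurable.aestronglyMeasurable (by fun_prop)) (ae_of_all _ fun x => ?_)
  have hprod (σ : Equiv.Perm (Fin m)) :
      ∏ l, ‖h (x l)‖ = ∏ a, ‖h (x (e (.inl a)))‖ * ‖h (x (e (.inr (σ a))))‖ := by
    rw [← e.prod_comp, Fintype.prod_sum_type, prod_mul_distrib,
      Equiv.prod_comp σ fun a => ‖h (x (e (.inr a)))‖]
  rw [norm_mul, norm_prod, Real.norm_of_nonneg (by positivity)]
  refine (mul_le_mul_of_nonneg_left (prod_norm_sub_rpow_le e hpos hneg x)
    (by positivity)).trans_eq ?_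
  rw [mul_sum]
  refine sum_congr rfl fun σ _ => ?_
  rw [hprod σ, ← prod_mul_distrib, norm_prod]
  refine prod_congr rfl fun a _ => ?_
  rw [norm_mul, norm_mul, Real.norm_of_nonneg (Real.rpow_nonneg (norm_nonneg _) _)]
  simp
end
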